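/- arXiv:chao-dyn/9303006 — 2 statements merged into one kernel-verified Lean document; each statement's English description precedes it below -/
import Mathlib

section
/- Let (Y,g) be a dynamical system on a nonempty compact metric space such that the ω-limit set ω(Y) of the whole space Y is finite. Then (Y,g) is a factor of a finite automaton: there exist finite sets A, Q, B, functions f_A : Q × A → Q, f_B : Q → B, and a continuous surjection φ from the finite automaton (X,f) over (A,Q,B) onto Y with g ∘ φ = φ ∘ f. -/
open Set Function Topology

/-- The ω-limit set of a set `A` under `f`: `ω(A) = ⋂ₙ closure (⋃_{m>n} f^m(A))`. -/
def omegaSet {X : Type*} [TopologicalSpace X] (f : X → X) (A : Set X) : Set X :=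
  ⋂ n : ℕ, closure (⋃ m : ℕ, ⋃ _ : n < m, f^[m] '' A)

/-- A dynamical system is chaotic if its periodic points are dense and it is
topologically transitive. -/
def IsChaotic {X : Type*} [TopologicalSpace X] (f : X → X) : Prop :=
  Dense {x : X | ∃ n : ℕ, 0 < n ∧ f^[n] x = x} ∧
  ∀ U V : Set X, IsOpen U → IsOpen V → U.Nonempty → V.Nonempty →
    ∃ k : ℕ, 0 < k ∧ (f^[k] '' U ∩ V).Nonempty

/-- `f` restricted to the invariant set `S` is a chaotic dynamical system. -/
def ChaoticOn {X : Type*} [TopologicalSpace X] (f : X → X) (S : Set X) : Prop :=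
  ∃ h : MapsTo f S S, IsChaotic (MapsTo.restrict f S S h)

/-- A system has chaotic limits if every point belongs to a set whose ω-limit set is
a chaotic system. -/
def HasChaoticLimits {X : Type*} [TopologicalSpace X] (f : X → X) : Prop :=
  ∀ x : X, ∃ A : Set X, x ∈ A ∧ ChaoticOn f (omegaSet f A)
/-- The discontinuum over `A, Q, B`: two-sided sequences with letters from `A` at
positive coordinates, a letter from `Q` at coordinate `0`, and letters from `B` at
negative coordinates. -/
def Discontinuum (A Q B : Type*) : Type _ :=
  {u : ℤ → A ⊕ Q ⊕ B //
    (∀ i : ℤ, 0 < i → ∃ a : A, u i = Sum.inl a) ∧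
    (∃ q : Q, u 0 = Sum.inr (Sum.inl q)) ∧
    (∀ i : ℤ, i < 0 → ∃ b : B, u i = Sum.inr (Sum.inr b))}

/-- The topology of the discontinuum: the product topology of the discrete topologies,
i.e. the topology of the metric ρ(u,v) = 2^{-inf{i ≥ 0 : uᵢ ≠ vᵢ or u₋ᵢ ≠ v₋ᵢ}}. -/
instance (A Q B : Type*) : TopologicalSpace (Discontinuum A Q B) := by
  letI : TopologicalSpace (A ⊕ Q ⊕ B) := ⊥
  unfold Discontinuum
  infer_instance

/-- The inner state of the automaton, i.e. the coordinate `u 0`. -/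
noncomputable def Discontinuum.state {A Q B : Type*} (u : Discontinuum A Q B) : Q :=
  u.2.2.1.choose

/-- The next input symbol, i.e. the coordinate `u 1`. -/
noncomputable def Discontinuum.input {A Q B : Type*} (u : Discontinuum A Q B) : A :=
  (u.2.1 1 one_pos).choose

/-- The dynamical system of a finite automaton with input function `fA` and output
function `fB`: it reads a symbol from the input tape, changes its state, and writes
a symbol to the output tape. -/
noncomputable def autMap {A Q B : Type*} (fA : Q × A → Q) (fB : Q → B)
    (u : Discontinuum A Q B) : Discontinuum A Q B :=
  ⟨fun i =>
    if i = -1 then Sum.inr (Sum.inr (fB u.state))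
    else if i = 0 then Sum.inr (Sum.inl (fA (u.state, u.input)))
    else u.1 (i + 1), by
      refine ⟨fun i hi => ?_, ?_, fun i hi => ?_⟩
      · beta_reduce
        rw [if_neg (by omega), if_neg (by omega)]
        exact u.2.1 (i + 1) (by omega)
      · exact ⟨fA (u.state, u.input), by beta_reduce; rw [if_neg (by norm_num), if_pos rfl]⟩
      · by_cases h : i = -1
        · exact ⟨fB u.state, by beta_reduce; rw [if_pos h]⟩
        · beta_reduce
          rw [if_neg h, if_neg (by omega)]
          exact u.2.2.2 (i + 1) (by omega)⟩

/-- A dynamical system `g` is a factor of a finite automaton if there are nonempty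
finite sets `A, Q, B`, input and output functions `fA, fB`, and a continuous
surjection `φ` from the corresponding finite automaton onto `(Y, g)` with
`g ∘ φ = φ ∘ f`. -/
def IsFactorOfFiniteAutomaton {Y : Type*} [TopologicalSpace Y] (g : Y → Y) : Prop :=
  ∃ (A Q B : Type) (_ : Fintype A) (_ : Fintype Q) (_ : Fintype B)
    (_ : Nonempty A) (_ : Nonempty Q) (_ : Nonempty B)
    (fA : Q × A → Q) (fB : Q → B) (φ : Discontinuum A Q B → Y),
    Continuous φ ∧ Surjective φ ∧ g ∘ φ = φ ∘ autMap fA fB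

/-- If a finite family of points carrying a permutation attracts everything uniformly, then
every point has a well defined, locally constant, asymptotic phase. -/
theorem exists_phase {Y Q : Type*} [MetricSpace Y] [Finite Q] (g : Y → Y) (hg : Continuous g)
    (c : Q → Y) (hc : Injective c) (σ : Equiv.Perm Q) (hσ : ∀ q, g (c q) = c (σ q))
    (hatt : ∀ ε > 0, ∃ N : ℕ, ∀ n ≥ N, ∀ y, ∃ q, dist (g^[n] y) (c q) < ε) :
    ∃ p : Y → Q, IsLocallyConstant p ∧
      ∀ ε > 0, ∃ N : ℕ, ∀ n ≥ N, ∀ y, dist (g^[n] y) (c ((σ ^ n) (p y))) < ε := by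
  obtain ⟨δ, hδ0, hδ⟩ : ∃ δ > (0 : ℝ), ∀ i j, i ≠ j → δ ≤ dist (c i) (c j) := by
    have h : ∀ᶠ δ : ℝ in 𝓝[>] 0, ∀ i j, i ≠ j → δ ≤ dist (c i) (c j) := by
      rw [Filter.eventually_all]; intro i
      rw [Filter.eventually_all]; intro j
      by_cases hij : i = j
      · simp [hij]
      · filter_upwards [Ioc_mem_nhdsGT (dist_pos.2 (hc.ne hij))] with δ h _ using h.2
    obtain ⟨δ, h1, h2⟩ := (h.and self_mem_nhdsWithin).exists
    exact ⟨δ, h2, h1⟩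
  have huniq : ∀ z i j, dist z (c i) < δ / 2 → dist z (c j) < δ / 2 → i = j := by
    intro z i j hi hj
    by_contra hij
    have := hδ i j hij
    have := dist_triangle_left (c i) (c j) z
    linarith
  obtain ⟨η, hη0, hηδ, hη⟩ : ∃ η > (0 : ℝ), η ≤ δ / 4 ∧
      ∀ q x, dist x (c q) < η → dist (g x) (c (σ q)) < δ / 2 := by
    have h : ∀ᶠ η : ℝ in 𝓝[>] 0, ∀ q x, dist x (c q) < η → dist (g x) (c (σ q)) < δ / 2 := by
      rw [Filter.eventually_all]; intro q
      obtain ⟨e, he, h⟩ := Metric.continuous_iff.1 hg (c q) (δ / 2) (by linarith)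
      filter_upwards [Ioc_mem_nhdsGT he] with η h1 x hx
      rw [← hσ]
      exact h x (hx.trans_le h1.2)
    have h4 : (0 : ℝ) < δ / 4 := by linarith
    obtain ⟨η, h1, h2⟩ := (h.and (Ioc_mem_nhdsGT h4)).exists
    exact ⟨η, h2.1, h2.2, h1⟩
  obtain ⟨N, hN⟩ := hatt η hη0
  choose d hd using fun y => hN N le_rfl y
  -- tracking
  have htrack : ∀ k y, dist (g^[N + k] y) (c ((σ ^ k) (d y))) < η := by
    intro k y
    induction k with
    | zero => simpa using hd y
    | succ k ih =>
      have h1 := hη _ _ ih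
      obtain ⟨q, hq⟩ := hN (N + (k + 1)) (by omega) y
      have h2 : g (g^[N + k] y) = g^[N + (k + 1)] y := by
        rw [← Function.iterate_succ_apply' g]; rfl
      rw [h2] at h1
      have h3 := huniq _ _ _ h1 (hq.trans_le (by linarith))
      rw [← h3] at hq
      rw [pow_succ', Equiv.Perm.mul_apply]
      exact hq
  have hpow : ∀ k y, (σ ^ (N + k)) ((σ ^ N)⁻¹ (d y)) = (σ ^ k) (d y) := by
    intro k y
    rw [← Equiv.Perm.mul_apply]
    congr 1
    rw [add_comm, pow_add, mul_assoc, mul_inv_cancel, mul_one]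
  refine ⟨fun y => (σ ^ N)⁻¹ (d y), ?_, ?_⟩
  · refine IsLocallyConstant.comp (f := d) ?_ _
    rw [IsLocallyConstant.iff_eventually_eq]
    intro y
    have hcont : ContinuousAt (g^[N]) y := (hg.iterate N).continuousAt
    have hh := Metric.continuousAt_iff'.1 hcont (δ / 4) (by linarith)
    filter_upwards [hh] with z hz
    apply huniq (g^[N] z)
    · exact (hd z).trans_le (by linarith)
    · have := dist_triangle (g^[N] z) (g^[N] y) (c (d y))
      have := hd y
      linarith
  · intro ε hε
    obtain ⟨M, hM⟩ := hatt (min ε η) (lt_min hε hη0)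
    refine ⟨max N M, fun n hn y => ?_⟩
    obtain ⟨k, rfl⟩ := Nat.exists_eq_add_of_le ((le_max_left N M).trans hn)
    obtain ⟨q, hq⟩ := hM (N + k) ((le_max_right N M).trans hn) y
    have hq1 := hq.trans_le (min_le_left _ _)
    have hq2 := hq.trans_le (min_le_right _ _)
    have h3 := huniq _ _ _ ((htrack k y).trans_le (by linarith)) (hq2.trans_le (by linarith))
    rw [hpow, h3]
    exact hq1

/-- The structure of a system with a finite ω-limit set. -/
theorem exists_structure {Y : Type*} [MetricSpace Y]
    [CompactSpace Y] [Nonempty Y] (g : Y → Y) (hg : Continuous g)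
    (hfin : (omegaSet g Set.univ).Finite) :
    ∃ (m : ℕ) (_ : Nonempty (Fin m)) (c : Fin m → Y) (σ : Equiv.Perm (Fin m)),
      Injective c ∧ (∀ q, g (c q) = c (σ q)) ∧
      (∀ ε > 0, ∃ N : ℕ, ∀ n ≥ N, ∀ y, ∃ q, dist (g^[n] y) (c q) < ε) := by
  set Ω := omegaSet g Set.univ with hΩ
  have hanti : Antitone (fun n : ℕ => range (g^[n])) := by
    refine antitone_nat_of_succ_le fun n => ?_
    rintro _ ⟨y, rfl⟩
    exact ⟨g y, rfl⟩
  have hcpt : ∀ n : ℕ, IsCompact (range (g^[n])) := fun n => isCompact_range (hg.iterate n)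
  have hcl : ∀ n : ℕ, IsClosed (range (g^[n])) := fun n => (hcpt n).isClosed
  have hΩeq : Ω = ⋂ n : ℕ, range (g^[n]) := by
    apply subset_antisymm
    · intro x hx
      refine mem_iInter.2 fun n => ?_
      have := mem_iInter.1 hx n
      refine closure_minimal ?_ (hcl n) this
      refine iUnion₂_subset fun m hm => ?_
      rw [image_univ]
      exact hanti hm.le
    · intro x hx
      refine mem_iInter.2 fun n => subset_closure ?_
      refine mem_iUnion₂.2 ⟨n + 1, by omega, ?_⟩
      rw [image_univ]
      exact mem_iInter.1 hx (n + 1)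
  have hne : Ω.Nonempty := by
    rw [hΩeq]
    exact IsCompact.nonempty_iInter_of_directed_nonempty_isCompact_isClosed _
      hanti.directed_ge (fun n => range_nonempty _) hcpt hcl
  have hmaps : MapsTo g Ω Ω := by
    intro x hx
    rw [hΩeq] at hx ⊢
    refine mem_iInter.2 fun n => ?_
    obtain ⟨y, rfl⟩ := mem_iInter.1 hx n
    exact ⟨g y, by rw [← Function.iterate_succ_apply, Function.iterate_succ_apply']⟩
  have hsurj : SurjOn g Ω Ω := by
    intro x hx
    have h : (⋂ n : ℕ, range (g^[n]) ∩ g ⁻¹' {x}).Nonempty := by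
      have hpc : IsClosed (g ⁻¹' {x}) := isClosed_singleton.preimage hg
      refine IsCompact.nonempty_iInter_of_directed_nonempty_isCompact_isClosed _
        (Antitone.directed_ge (fun a b hab => inter_subset_inter_left _ (hanti hab))) (fun n => ?_)
        (fun n => (hcpt n).inter_right hpc) (fun n => (hcl n).inter hpc)
      rw [hΩeq] at hx
      obtain ⟨y, hy⟩ := mem_iInter.1 hx (n + 1)
      refine ⟨g^[n] y, ⟨y, rfl⟩, ?_⟩
      rw [Function.iterate_succ_apply'] at hy
      exact hy
    obtain ⟨z, hz⟩ := h
    rw [mem_iInter] at hz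
    refine ⟨z, ?_, (hz 0).2⟩
    rw [hΩeq]
    exact mem_iInter.2 fun n => (hz n).1
  haveI : Finite Ω := hfin
  have hs : Surjective (MapsTo.restrict g Ω Ω hmaps) := by
    rintro ⟨x, hx⟩
    obtain ⟨z, hz, rfl⟩ := hsurj hx
    exact ⟨⟨z, hz⟩, rfl⟩
  let τ : Equiv.Perm Ω := Equiv.ofBijective _ ⟨Finite.injective_iff_surjective.2 hs, hs⟩
  obtain ⟨m, ⟨e⟩⟩ := Finite.exists_equiv_fin Ω
  obtain ⟨x₀, hx₀⟩ := hne
  refine ⟨m, ⟨e ⟨x₀, hx₀⟩⟩, fun i => (e.symm i : Y), (e.symm.trans τ).trans e, ?_, ?_, ?_⟩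
  · exact Subtype.val_injective.comp e.symm.injective
  · intro q
    simp only [Equiv.trans_apply, Equiv.symm_apply_apply]
    rfl
  · intro ε hε
    obtain ⟨N, hN⟩ := exists_subset_nhds_of_isCompact' (V := fun n : ℕ => range (g^[n]))
      hanti.directed_ge hcpt hcl (U := ⋃ x ∈ Ω, Metric.ball x ε) (by
        intro x hx
        rw [← hΩeq] at hx
        exact Filter.mem_of_superset (Metric.ball_mem_nhds x hε)
          (subset_biUnion_of_mem (u := fun x => Metric.ball x ε) hx))
    refine ⟨N, fun n hn y => ?_⟩
    have := hN (hanti hn ⟨y, rfl⟩)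
    obtain ⟨x, hx, hxy⟩ := mem_iUnion₂.1 this
    exact ⟨e ⟨x, hx⟩, by simpa using hxy⟩

section Aut

variable {A Q B : Type}

/-- The output tape at coordinate `-(n+1)`. -/
noncomputable def tapeOut (u : Discontinuum A Q B) (n : ℕ) : B :=
  (u.2.2.2 (-(n + 1 : ℤ)) (by omega)).choose

theorem tapeOut_spec (u : Discontinuum A Q B) (n : ℕ) :
    u.1 (-(n + 1 : ℤ)) = Sum.inr (Sum.inr (tapeOut u n)) :=
  (u.2.2.2 (-(n + 1 : ℤ)) (by omega)).choose_spec

theorem state_spec (u : Discontinuum A Q B) : u.1 0 = Sum.inr (Sum.inl u.state) :=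
  u.2.2.1.choose_spec

theorem tapeOut_eq {u : Discontinuum A Q B} {n : ℕ} {b : B}
    (h : u.1 (-(n + 1 : ℤ)) = Sum.inr (Sum.inr b)) : tapeOut u n = b := by
  rw [tapeOut_spec] at h
  simpa using h

theorem state_eq {u : Discontinuum A Q B} {q : Q}
    (h : u.1 0 = Sum.inr (Sum.inl q)) : u.state = q := by
  rw [state_spec] at h
  simpa using h

theorem state_autMap (fA : Q × A → Q) (fB : Q → B) (u : Discontinuum A Q B) :
    (autMap fA fB u).state = fA (u.state, u.input) :=
  state_eq (by simp [autMap])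

theorem tapeOut_autMap_zero (fA : Q × A → Q) (fB : Q → B) (u : Discontinuum A Q B) :
    tapeOut (autMap fA fB u) 0 = fB u.state :=
  tapeOut_eq (by simp [autMap])

theorem tapeOut_autMap_succ (fA : Q × A → Q) (fB : Q → B) (u : Discontinuum A Q B) (n : ℕ) :
    tapeOut (autMap fA fB u) (n + 1) = tapeOut u n := by
  apply tapeOut_eq
  rw [← tapeOut_spec]
  simp only [autMap]
  rw [if_neg (by omega), if_neg (by omega)]
  congr 1

theorem isLocallyConstant_coord (i : ℤ) :
    IsLocallyConstant (fun u : Discontinuum A Q B => u.1 i) := by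
  letI : TopologicalSpace (A ⊕ Q ⊕ B) := ⊥
  haveI : DiscreteTopology (A ⊕ Q ⊕ B) := ⟨rfl⟩
  rw [IsLocallyConstant.iff_continuous]
  exact (continuous_apply i).comp continuous_subtype_val

theorem eventually_state (u : Discontinuum A Q B) : ∀ᶠ v in 𝓝 u, v.state = u.state := by
  filter_upwards [(IsLocallyConstant.iff_eventually_eq _).1 (isLocallyConstant_coord 0) u] with v hv
  exact state_eq (hv.trans (state_spec u))

theorem eventually_tapeOut (u : Discontinuum A Q B) (n : ℕ) :
    ∀ᶠ v in 𝓝 u, tapeOut v n = tapeOut u n := by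
  filter_upwards [(IsLocallyConstant.iff_eventually_eq _).1
    (isLocallyConstant_coord (-(n + 1 : ℤ))) u] with v hv
  exact tapeOut_eq (hv.trans (tapeOut_spec u n))

theorem exists_discontinuum [Nonempty A] (q : Q) (b : ℕ → B) :
    ∃ u : Discontinuum A Q B, u.state = q ∧ ∀ n, tapeOut u n = b n := by
  obtain ⟨a⟩ := ‹Nonempty A›
  let u : Discontinuum A Q B := ⟨fun i => if 0 < i then Sum.inl a else
    if i = 0 then Sum.inr (Sum.inl q) else Sum.inr (Sum.inr (b (-i - 1).toNat)), by
      refine ⟨fun i hi => ⟨a, by simp [hi]⟩, ⟨q, by simp⟩, fun i hi => ⟨b (-i - 1).toNat, ?_⟩⟩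
      beta_reduce
      rw [if_neg (by omega), if_neg (by omega)]⟩
  refine ⟨u, state_eq (by simp [u]), fun n => tapeOut_eq ?_⟩
  simp only [u]
  rw [if_neg (by omega), if_neg (by omega)]
  congr 3
  omega

end Aut

theorem perm_inv_apply {Q : Type*} (σ : Equiv.Perm Q) (q : Q) :
    (σ⁻¹ : Equiv.Perm Q) (σ q) = q := σ.symm_apply_apply q

theorem perm_apply_inv {Q : Type*} (σ : Equiv.Perm Q) (q : Q) :
    σ ((σ⁻¹ : Equiv.Perm Q) q) = q := σ.apply_symm_apply q

section Factor

variable {Y Q : Type*}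

open Classical in
/-- The factor map in terms of the state and the output tape: `k` is the number of blanks at the
beginning of the tape. -/
noncomputable def decodeAt (g : Y → Y) (c : Q → Y) (σ : Equiv.Perm Q) (p : Y → Q)
    (ψ : (ℕ → Bool) → Y) (k : ℕ) (q : Q) (b : ℕ → Option Bool) : Y :=
  let y := ψ (fun i => (b (k + i)).getD false)
  let q₀ := ((σ ^ k)⁻¹ : Equiv.Perm Q) q
  g^[k] (if p y = q₀ then y else c q₀)

open Classical in
/-- The factor map in terms of the state and the output tape. -/
noncomputable def decode (g : Y → Y) (c : Q → Y) (σ : Equiv.Perm Q) (p : Y → Q)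
    (ψ : (ℕ → Bool) → Y) (q : Q) (b : ℕ → Option Bool) : Y :=
  if h : ∃ n, b n ≠ none then decodeAt g c σ p ψ (Nat.find h) q b else c q

theorem decode_of_first (g : Y → Y) (c : Q → Y) (σ : Equiv.Perm Q) (p : Y → Q)
    (ψ : (ℕ → Bool) → Y) (q : Q) (b : ℕ → Option Bool) (k : ℕ) (hk : b k ≠ none)
    (hlt : ∀ i < k, b i = none) : decode g c σ p ψ q b = decodeAt g c σ p ψ k q b := by
  classical
  have h : ∃ n, b n ≠ none := ⟨k, hk⟩
  have hf : Nat.find h = k := by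
    rw [Nat.find_eq_iff]
    exact ⟨hk, fun n hn => by simpa using hlt n hn⟩
  rw [decode, dif_pos h, hf]

theorem decode_of_blank (g : Y → Y) (c : Q → Y) (σ : Equiv.Perm Q) (p : Y → Q)
    (ψ : (ℕ → Bool) → Y) (q : Q) (b : ℕ → Option Bool) (hb : ∀ i, b i = none) :
    decode g c σ p ψ q b = c q := by
  rw [decode, dif_neg]
  push Not
  exact hb

theorem blank_or_first (b : ℕ → Option Bool) :
    (∀ i, b i = none) ∨ ∃ k, b k ≠ none ∧ ∀ i < k, b i = none := by
  classical
  by_cases h : ∃ n, b n ≠ none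
  · refine Or.inr ⟨Nat.find h, Nat.find_spec h, fun i hi => ?_⟩
    have := Nat.find_min h hi
    simpa using this
  · push Not at h
    exact Or.inl h

theorem decode_step (g : Y → Y) (c : Q → Y) (σ : Equiv.Perm Q) (p : Y → Q)
    (hσ : ∀ q, g (c q) = c (σ q))
    (ψ : (ℕ → Bool) → Y) (q : Q) (b b' : ℕ → Option Bool) (h0 : b' 0 = none)
    (hs : ∀ n, b' (n + 1) = b n) :
    decode g c σ p ψ (σ q) b' = g (decode g c σ p ψ q b) := by
  rcases blank_or_first b with hb | ⟨k, hk, hlt⟩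
  · rw [decode_of_blank _ _ _ _ _ _ b hb, decode_of_blank _ _ _ _ _ _ b', hσ]
    rintro (_ | i)
    · exact h0
    · rw [hs, hb]
  · rw [decode_of_first _ _ _ _ _ _ b k hk hlt, decode_of_first _ _ _ _ _ _ b' (k + 1)]
    · have h1 : ((σ ^ (k + 1))⁻¹ : Equiv.Perm Q) (σ q) = ((σ ^ k)⁻¹ : Equiv.Perm Q) q := by
        rw [pow_succ', mul_inv_rev, Equiv.Perm.mul_apply, perm_inv_apply]
      have h2 : (fun i => (b' (k + 1 + i)).getD false) = fun i => (b (k + i)).getD false := by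
        funext i
        rw [← hs (k + i)]
        congr 2
        omega
      simp only [decodeAt]
      rw [h1, h2, Function.iterate_succ_apply']
    · rwa [hs]
    · rintro (_ | i) hi
      · exact h0
      · rw [hs, hlt i (by omega)]

theorem iterate_center (g : Y → Y) (c : Q → Y) (σ : Equiv.Perm Q)
    (hσ : ∀ q, g (c q) = c (σ q)) (n : ℕ) (q : Q) : g^[n] (c q) = c ((σ ^ n) q) := by
  induction n with
  | zero => simp
  | succ n ih => rw [Function.iterate_succ_apply', ih, hσ, pow_succ', Equiv.Perm.mul_apply]

theorem dist_decodeAt [MetricSpace Y] (g : Y → Y) (c : Q → Y) (σ : Equiv.Perm Q) (p : Y → Q)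
    (hσ : ∀ q, g (c q) = c (σ q)) (ψ : (ℕ → Bool) → Y) (ε : ℝ) (hε : 0 < ε) (k : ℕ)
    (hk : ∀ y, dist (g^[k] y) (c ((σ ^ k) (p y))) < ε) (q : Q) (b : ℕ → Option Bool) :
    dist (decodeAt g c σ p ψ k q b) (c q) < ε := by
  simp only [decodeAt]
  split_ifs with h
  · have := hk (ψ fun i => (b (k + i)).getD false)
    rwa [h, perm_apply_inv] at this
  · rw [iterate_center g c σ hσ, perm_apply_inv, dist_self]
    exact hε

theorem continuous_decodeAt [TopologicalSpace Y] (g : Y → Y) (hg : Continuous g) (c : Q → Y)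
    (σ : Equiv.Perm Q) (p : Y → Q) (hp : IsLocallyConstant p)
    (ψ : (ℕ → Bool) → Y) (hψ : Continuous ψ) (k : ℕ) (q : Q) {X : Type*} [TopologicalSpace X]
    (t : X → ℕ → Option Bool) (ht : ∀ x n, ∀ᶠ z in 𝓝 x, t z n = t x n) :
    Continuous (fun x => decodeAt g c σ p ψ k q (t x)) := by
  classical
  have hd : Continuous (fun x => ψ (fun i => (t x (k + i)).getD false)) := by
    refine hψ.comp (continuous_pi fun i => ?_)
    refine IsLocallyConstant.continuous ?_
    rw [IsLocallyConstant.iff_eventually_eq]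
    intro x
    filter_upwards [ht x (k + i)] with z hz
    rw [hz]
  have hr : Continuous (fun y => if p y = ((σ ^ k)⁻¹ : Equiv.Perm Q) q then y
      else c (((σ ^ k)⁻¹ : Equiv.Perm Q) q)) := by
    rw [continuous_iff_continuousAt]
    intro y
    have hev := (IsLocallyConstant.iff_eventually_eq p).1 hp y
    by_cases h : p y = ((σ ^ k)⁻¹ : Equiv.Perm Q) q
    · refine (continuousAt_id (x := y)).congr ?_
      filter_upwards [hev] with z hz
      simp [hz, h]
    · refine (continuousAt_const (x := y) (y := c (((σ ^ k)⁻¹ : Equiv.Perm Q) q))).congr ?_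
      filter_upwards [hev] with z hz
      rw [if_neg (by rwa [hz])]
  exact (hg.iterate k).comp (hr.comp hd)

end Factor

/-- A dynamical system on a nonempty compact metric space whose ω-limit set `ω(Y)`
is finite is a factor of a finite automaton. -/
theorem isFactorOfFiniteAutomaton_of_finite_omega {Y : Type*} [MetricSpace Y]
    [CompactSpace Y] [Nonempty Y] (g : Y → Y) (hg : Continuous g)
    (hfin : (omegaSet g Set.univ).Finite) :
    IsFactorOfFiniteAutomaton g := by
  obtain ⟨m, hm, c, σ, hc, hσ, hatt⟩ := exists_structure g hg hfin
  obtain ⟨p, hp, hpa⟩ := exists_phase g hg c hc σ hσ hatt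
  obtain ⟨ψ, hψ, hψs⟩ := exists_nat_bool_continuous_surjective_of_compact Y
  refine ⟨Unit, Fin m, Option Bool, inferInstance, inferInstance, inferInstance, inferInstance,
    hm, inferInstance, fun x => σ x.1, fun _ => none,
    fun u => decode g c σ p ψ u.state (tapeOut u), ?_, ?_, ?_⟩
  · rw [continuous_iff_continuousAt]
    intro u
    rcases blank_or_first (tapeOut u) with hb | ⟨k, hk, hlt⟩
    · rw [Metric.continuousAt_iff']
      intro ε hε
      obtain ⟨N, hN⟩ := hpa ε hε
      have hev : ∀ᶠ v in 𝓝 u, ∀ i ∈ Finset.range N, tapeOut v i = tapeOut u i :=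
        (Filter.eventually_all_finset _).2 fun i _ => eventually_tapeOut u i
      filter_upwards [hev, eventually_state u] with v hv hvs
      rw [decode_of_blank _ _ _ _ _ _ _ hb, hvs]
      rcases blank_or_first (tapeOut v) with hb' | ⟨k, hk, hlt⟩
      · rw [decode_of_blank _ _ _ _ _ _ _ hb', dist_self]
        exact hε
      · rw [decode_of_first _ _ _ _ _ _ _ k hk hlt]
        refine dist_decodeAt g c σ p hσ ψ ε hε k (hN k ?_) _ _
        by_contra hkN
        exact hk ((hv k (Finset.mem_range.2 (by omega))).trans (hb k))
    · have hcont := continuous_decodeAt g hg c σ p hp ψ hψ k u.state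
        (fun v : Discontinuum Unit (Fin m) (Option Bool) => tapeOut v) eventually_tapeOut
      refine (hcont.continuousAt (x := u)).congr ?_
      have hev : ∀ᶠ v in 𝓝 u, ∀ i ∈ Finset.range (k + 1), tapeOut v i = tapeOut u i :=
        (Filter.eventually_all_finset _).2 fun i _ => eventually_tapeOut u i
      filter_upwards [hev, eventually_state u] with v hv hvs
      rw [hvs, decode_of_first _ _ _ _ _ _ _ k]
      · rw [hv k (by simp)]
        exact hk
      · intro i hi
        rw [hv i (Finset.mem_range.2 (by omega))]
        exact hlt i hi
  · intro y
    obtain ⟨d, rfl⟩ := hψs y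
    obtain ⟨u, hu, hut⟩ := exists_discontinuum (A := Unit) (p (ψ d)) (fun n => some (d n))
    refine ⟨u, ?_⟩
    beta_reduce
    rw [decode_of_first _ _ _ _ _ _ _ 0 (by rw [hut]; simp) (by simp), hu]
    simp [decodeAt, hut]
  · funext u
    simp only [Function.comp_apply]
    rw [state_autMap]
    exact (decode_step g c σ p hσ ψ _ _ _ (tapeOut_autMap_zero _ _ u)
      (tapeOut_autMap_succ _ _ u)).symm
end

section
/- Let g : [-1,1] → [-1,1] be a symmetric unimodal system with only finitely many periodic points (points x with g^n(x) = x for some n > 0). Then ([-1,1],g) is a factor of a finite automaton. -/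
open Set Function Topology

/-- A symmetric unimodal function on `I = [-1,1]`: continuously differentiable,
symmetric, `g(-1) = g(1) = -1`, `g(0) > -1`, and `g'(x) = 0` iff `x = 0`. -/
def SymmetricUnimodal (g : ℝ → ℝ) : Prop :=
  ContDiffOn ℝ 1 g (Set.Icc (-1) 1) ∧
  (∀ x ∈ Set.Icc (-1:ℝ) 1, g (-x) = g x) ∧
  g (-1) = -1 ∧ g 1 = -1 ∧ -1 < g 0 ∧
  ∀ x ∈ Set.Icc (-1:ℝ) 1, (derivWithin g (Set.Icc (-1) 1) x = 0 ↔ x = 0)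

/-! ### Coding by one-sided tapes -/

/-- Prepend a letter to a sequence. -/
def consSeq {B : Type} (b : B) (o : ℕ → B) : ℕ → B
  | 0 => b
  | n + 1 => o n

/-- One step of the automaton on triples (output tape, state, input tape). -/
def triStep {A Q B : Type} (fA : Q × A → Q) (fB : Q → B)
    (t : (ℕ → B) × Q × (ℕ → A)) : (ℕ → B) × Q × (ℕ → A) :=
  (consSeq (fB t.2.1) t.1, fA (t.2.1, t.2.2 0), fun n => t.2.2 (n + 1))

/-- Projections with default values. -/
noncomputable def prA {A Q B : Type} [Nonempty A] : A ⊕ Q ⊕ B → A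
  | Sum.inl a => a
  | _ => Classical.arbitrary A

noncomputable def prQ {A Q B : Type} [Nonempty Q] : A ⊕ Q ⊕ B → Q
  | Sum.inr (Sum.inl q) => q
  | _ => Classical.arbitrary Q

noncomputable def prB {A Q B : Type} [Nonempty B] : A ⊕ Q ⊕ B → B
  | Sum.inr (Sum.inr b) => b
  | _ => Classical.arbitrary B

noncomputable def decTri {A Q B : Type} [Nonempty A] [Nonempty Q] [Nonempty B]
    (u : Discontinuum A Q B) : (ℕ → B) × Q × (ℕ → A) :=
  (fun n => prB (u.1 (-(n : ℤ) - 1)), prQ (u.1 0), fun n => prA (u.1 ((n : ℤ) + 1)))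

lemma discontinuum_coord_continuous {A Q B D : Type} [TopologicalSpace D]
    (h : A ⊕ Q ⊕ B → D) (i : ℤ) :
    Continuous (fun u : Discontinuum A Q B => h (u.1 i)) := by
  let _ : TopologicalSpace (A ⊕ Q ⊕ B) := ⊥
  have : DiscreteTopology (A ⊕ Q ⊕ B) := ⟨rfl⟩
  have h1 : Continuous (fun u : Discontinuum A Q B => u.1 i) := by
    have : Continuous (fun u : Discontinuum A Q B => u.1) := by
      exact continuous_subtype_val
    exact (continuous_apply i).comp this
  exact (continuous_of_discreteTopology (f := h)).comp h1

lemma decTri_continuous {A Q B : Type} [Nonempty A] [Nonempty Q] [Nonempty B]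
    [TopologicalSpace A] [TopologicalSpace Q] [TopologicalSpace B] :
    Continuous (decTri : Discontinuum A Q B → _) := by
  unfold decTri
  refine Continuous.prodMk ?_ (Continuous.prodMk ?_ ?_)
  · exact continuous_pi fun n => discontinuum_coord_continuous prB _
  · exact discontinuum_coord_continuous prQ _
  · exact continuous_pi fun n => discontinuum_coord_continuous prA _

lemma decTri_surjective {A Q B : Type} [Nonempty A] [Nonempty Q] [Nonempty B] :
    Surjective (decTri : Discontinuum A Q B → _) := by
  rintro ⟨o, q, i⟩
  refine ⟨⟨fun k => if 0 < k then Sum.inl (i (k - 1).toNat) else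
    if k = 0 then Sum.inr (Sum.inl q) else Sum.inr (Sum.inr (o (-k - 1).toNat)), ?_, ?_, ?_⟩, ?_⟩
  · intro k hk
    exact ⟨i (k - 1).toNat, by simp [hk]⟩
  · exact ⟨q, by simp⟩
  · intro k hk
    exact ⟨o (-k - 1).toNat, by
      have h1 : ¬ 0 < k := by omega
      have h2 : k ≠ 0 := by omega
      simp [h1, h2]⟩
  · unfold decTri
    refine Prod.ext ?_ (Prod.ext ?_ ?_)
    · funext n
      have h1 : ¬ (0 < -(n : ℤ) - 1) := by omega
      have h2 : ¬ (-(n : ℤ) - 1 = 0) := by omega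
      simp only [h1, h2, if_false, prB]
      congr 1
      omega
    · simp [prQ]
    · funext n
      have h1 : (0 < (n : ℤ) + 1) := by omega
      simp only [h1, if_true, prA]
      congr 1
      omega

lemma decTri_autMap {A Q B : Type} [Nonempty A] [Nonempty Q] [Nonempty B]
    (fA : Q × A → Q) (fB : Q → B) (u : Discontinuum A Q B) :
    decTri (autMap fA fB u) = triStep fA fB (decTri u) := by
  have hq : u.1 0 = Sum.inr (Sum.inl u.state) := u.2.2.1.choose_spec
  have ha : u.1 1 = Sum.inl u.input := (u.2.1 1 one_pos).choose_spec
  unfold triStep decTri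
  refine Prod.ext ?_ (Prod.ext ?_ ?_)
  · funext n
    cases n with
    | zero => simp [autMap, prB, consSeq, hq, prQ]
    | succ n =>
      have h1 : ¬ (-((n + 1 : ℕ) : ℤ) - 1 = -1) := by omega
      have h2 : ¬ (-((n + 1 : ℕ) : ℤ) - 1 = 0) := by omega
      simp only [autMap, h1, h2, if_false, consSeq]
      have h3 : -((n + 1 : ℕ) : ℤ) - 1 + 1 = -(n : ℤ) - 1 := by push_cast; ring
      rw [h3]
  · simp [autMap, hq, ha, prQ, prA]
  · funext n
    have h1 : ¬ ((n : ℤ) + 1 = -1) := by omega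
    have h2 : ¬ ((n : ℤ) + 1 = 0) := by omega
    simp only [autMap, h1, h2, if_false]
    congr 2

lemma factor_of_tri {Y : Type} [TopologicalSpace Y] (g : Y → Y) {A Q B : Type}
    [Finite A] [Finite Q] [Finite B] [Nonempty A] [Nonempty Q] [Nonempty B]
    [TopologicalSpace A] [TopologicalSpace Q] [TopologicalSpace B]
    (fA : Q × A → Q) (fB : Q → B) (ψ : (ℕ → B) × Q × (ℕ → A) → Y)
    (hc : Continuous ψ) (hs : Surjective ψ) (hψ : ∀ t, g (ψ t) = ψ (triStep fA fB t)) :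
    IsFactorOfFiniteAutomaton g := by
  refine ⟨A, Q, B, Fintype.ofFinite A, Fintype.ofFinite Q, Fintype.ofFinite B, inferInstance,
    inferInstance, inferInstance, fA, fB, ψ ∘ decTri, hc.comp decTri_continuous,
    hs.comp decTri_surjective, ?_⟩
  funext u
  simp only [comp_apply, hψ, decTri_autMap]

/-- A closed-relation construction of a factor map. -/
lemma closed_relation_factor {X Y : Type} [TopologicalSpace X] [TopologicalSpace Y] [CompactSpace Y]
    [T2Space Y] (F : X → X) (hF : Continuous F) (g : Y → Y) (hg : Continuous g)
    (Z : X → Set Y) (hZ : IsClosed {q : X × Y | q.2 ∈ Z q.1})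
    (hne : ∀ u, (Z u).Nonempty) (hZF : ∀ u, Z (F u) ⊆ g '' Z u)
    (huniq : ∀ u x x', (∀ n, g^[n] x ∈ Z (F^[n] u)) → (∀ n, g^[n] x' ∈ Z (F^[n] u)) → x = x') :
    ∃ ψ : X → Y, Continuous ψ ∧ (∀ u, g (ψ u) = ψ (F u)) ∧
      (∀ u x, (∀ n, g^[n] x ∈ Z (F^[n] u)) → ψ u = x) := by
  have hcl : ∀ n, IsClosed {q : X × Y | g^[n] q.2 ∈ Z (F^[n] q.1)} := by
    intro n
    have hcont : Continuous (fun q : X × Y => (F^[n] q.1, g^[n] q.2)) :=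
      ((hF.iterate n).comp continuous_fst).prodMk ((hg.iterate n).comp continuous_snd)
    exact hZ.preimage hcont
  have hfin : ∀ n u, {x | ∀ i ≤ n, g^[i] x ∈ Z (F^[i] u)}.Nonempty := by
    intro n
    induction n with
    | zero =>
      intro u
      obtain ⟨x, hx⟩ := hne u
      refine ⟨x, fun i hi => ?_⟩
      obtain rfl : i = 0 := by omega
      exact hx
    | succ n ih =>
      intro u
      obtain ⟨y, hy⟩ := ih (F u)
      obtain ⟨x, hx, hxy⟩ := hZF u (hy 0 (Nat.zero_le _))
      refine ⟨x, fun i hi => ?_⟩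
      cases i with
      | zero => exact hx
      | succ i =>
        rw [iterate_succ_apply, iterate_succ_apply, hxy]
        exact hy i (by omega)
  have hex : ∀ u, ∃ x, ∀ n, g^[n] x ∈ Z (F^[n] u) := by
    intro u
    have hcl' : ∀ n, IsClosed {x | ∀ i ≤ n, g^[i] x ∈ Z (F^[i] u)} := by
      intro n
      have : {x | ∀ i ≤ n, g^[i] x ∈ Z (F^[i] u)} =
          ⋂ i, ⋂ _ : i ≤ n, {x | g^[i] x ∈ Z (F^[i] u)} := by
        ext x; simp
      rw [this]
      refine isClosed_iInter fun i => isClosed_iInter fun _ => ?_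
      exact (hcl i).preimage (Continuous.prodMk_right u)
    obtain ⟨x, hx⟩ := IsCompact.nonempty_iInter_of_sequence_nonempty_isCompact_isClosed
      (fun n => {x | ∀ i ≤ n, g^[i] x ∈ Z (F^[i] u)})
      (fun n x hx i hi => hx i (by omega)) (fun n => hfin n u) (hcl' 0).isCompact hcl'
    rw [mem_iInter] at hx
    exact ⟨x, fun n => hx n n le_rfl⟩
  choose ψ hψ using hex
  refine ⟨ψ, ?_, ?_, fun u x hx => huniq u _ _ (hψ u) hx⟩
  · have : {q : X × Y | ψ q.1 = q.2} = ⋂ n, {q : X × Y | g^[n] q.2 ∈ Z (F^[n] q.1)} := by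
      ext ⟨u, x⟩
      simp only [mem_ofPred_eq, mem_iInter]
      constructor
      · rintro rfl; exact hψ u
      · intro hx; exact huniq u _ _ (hψ u) hx
    have h2 := isClosed_iInter hcl
    rw [← this] at h2
    rw [continuous_iff_isClosed]
    intro T hT
    have h3 : ψ ⁻¹' T = Prod.fst '' ({q : X × Y | ψ q.1 = q.2} ∩ Prod.snd ⁻¹' T) := by
      ext u
      constructor
      · intro hu; exact ⟨(u, ψ u), ⟨rfl, hu⟩, rfl⟩
      · rintro ⟨⟨v, x⟩, ⟨h4, h5⟩, rfl⟩
        have h4' : ψ v = x := h4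
        change ψ v ∈ T
        rw [h4']; exact h5
    rw [h3]
    exact isClosedMap_fst_of_compactSpace _ (h2.inter (hT.preimage continuous_snd))
  · intro u
    refine huniq (F u) _ _ (fun n => ?_) (hψ _)
    have := hψ u (n + 1)
    rwa [iterate_succ_apply, iterate_succ_apply] at this

/-! ### Markov systems with attracting part -/

lemma continuous_consSeq {T D : Type} [TopologicalSpace T] [TopologicalSpace D]
    {b : T → D} {o : T → ℕ → D} (hb : Continuous b) (ho : Continuous o) :
    Continuous (fun t => consSeq (b t) (o t)) := by
  refine continuous_pi fun n => ?_
  cases n with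
  | zero => exact hb
  | succ n => exact (continuous_apply n).comp ho

lemma continuous_tailSeq {T D : Type} [TopologicalSpace T] [TopologicalSpace D]
    {o : T → ℕ → D} (ho : Continuous o) :
    Continuous (fun t => fun n => o t (n + 1)) :=
  continuous_pi fun n => (continuous_apply (n + 1)).comp ho

lemma triStep_continuous {A Q B : Type} [TopologicalSpace A] [TopologicalSpace Q]
    [TopologicalSpace B] [DiscreteTopology A] [DiscreteTopology Q]
    (fA : Q × A → Q) (fB : Q → B) : Continuous (triStep fA fB) := by
  unfold triStep
  refine Continuous.prodMk ?_ (Continuous.prodMk ?_ ?_)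
  · exact continuous_consSeq
      ((continuous_of_discreteTopology (f := fB)).comp (continuous_fst.comp continuous_snd))
      continuous_fst
  · exact (continuous_of_discreteTopology (f := fA)).comp
      ((continuous_fst.comp continuous_snd).prodMk
        ((continuous_apply 0).comp (continuous_snd.comp continuous_snd)))
  · exact continuous_tailSeq (continuous_snd.comp continuous_snd)

/-- Approximate value of a configuration in the attracting part. -/
def approxVal {Y P E : Type} (g : Y → Y) (τ : P ≃ P) (pt : P → Y) (κ : E → P → (ℕ → Bool) → Y) :
    ℕ → (ℕ → E ⊕ Bool) → P → (ℕ → Bool) → Y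
  | 0, _, p, _ => pt p
  | m + 1, o, p, w =>
    Sum.elim (fun c => g (κ c (τ.symm p) w))
      (fun b => g (approxVal g τ pt κ m (fun n => o (n + 1)) (τ.symm p) (consSeq b w))) (o 0)

lemma approxVal_continuous {Y P E : Type} [TopologicalSpace Y] [TopologicalSpace E]
    [DiscreteTopology E] (g : Y → Y) (hg : Continuous g)
    (τ : P ≃ P) (pt : P → Y) (κ : E → P → (ℕ → Bool) → Y) (hκ : ∀ c p, Continuous (κ c p)) (m : ℕ) :
    ∀ p, Continuous (fun t : (ℕ → E ⊕ Bool) × (ℕ → Bool) => approxVal g τ pt κ m t.1 p t.2) := by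
  induction m with
  | zero => intro p; exact continuous_const
  | succ m ih =>
    intro p
    have h1 : Continuous (fun s : (E ⊕ Bool) × ((ℕ → E ⊕ Bool) × (ℕ → Bool)) =>
        Sum.elim (fun c => g (κ c (τ.symm p) s.2.2))
          (fun b => g (approxVal g τ pt κ m (fun n => s.2.1 (n + 1)) (τ.symm p)
            (consSeq b s.2.2))) s.1) := by
      rw [continuous_prod_of_discrete_left]
      rintro (c | b)
      · exact hg.comp ((hκ _ _).comp continuous_snd)
      · refine hg.comp ((ih (τ.symm p)).comp (Continuous.prodMk ?_ ?_))
        · exact continuous_tailSeq continuous_fst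
        · exact continuous_consSeq continuous_const continuous_snd
    have h2 : Continuous (fun t : (ℕ → E ⊕ Bool) × (ℕ → Bool) => (t.1 0, t)) :=
      Continuous.prodMk ((continuous_apply 0).comp continuous_fst) continuous_id
    exact h1.comp h2

lemma approxVal_mem {Y P E : Type} (g : Y → Y) (τ : P ≃ P) (pt : P → Y)
    (κ : E → P → (ℕ → Bool) → Y) (K : P → Set Y) (hpt : ∀ p, pt p ∈ K p)
    (hκ : ∀ c p w, κ c p w ∈ K p) (hgK : ∀ p, ∀ y ∈ K p, g y ∈ K (τ p)) (m : ℕ) :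
    ∀ o p w, approxVal g τ pt κ m o p w ∈ K p := by
  induction m with
  | zero => intro o p w; exact hpt p
  | succ m ih =>
    intro o p w
    unfold approxVal
    have key : ∀ y ∈ K (τ.symm p), g y ∈ K p := by
      intro y hy
      have := hgK _ y hy
      rwa [Equiv.apply_symm_apply] at this
    rcases o 0 with c | b
    · exact key _ (hκ _ _ _)
    · exact key _ (ih _ _ _)

lemma approxVal_close {Y P E : Type} (g : Y → Y) (τ : P ≃ P) (pt : P → Y)
    (κ : E → P → (ℕ → Bool) → Y) (K : P → Set Y) (hpt : ∀ p, pt p ∈ K p)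
    (hκ : ∀ c p w, κ c p w ∈ K p) (hgK : ∀ p, ∀ y ∈ K p, g y ∈ K (τ p))
    (hgpt : ∀ p, g (pt p) = pt (τ p)) (m k : ℕ) :
    ∀ o p w, approxVal g τ pt κ (m + k) o p w = approxVal g τ pt κ m o p w ∨
      ∃ q, ∃ y ∈ K q, approxVal g τ pt κ (m + k) o p w = g^[m] y ∧
        approxVal g τ pt κ m o p w = g^[m] (pt q) := by
  induction m with
  | zero =>
    intro o p w
    exact Or.inr ⟨p, _, approxVal_mem g τ pt κ K hpt hκ hgK (0 + k) o p w, rfl, rfl⟩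
  | succ m ih =>
    intro o p w
    rw [show m + 1 + k = (m + k) + 1 by ring]
    unfold approxVal
    rcases o 0 with c | b
    · exact Or.inl rfl
    · simp only [Sum.elim_inr]
      rcases ih (fun n => o (n + 1)) (τ.symm p) (consSeq b w) with h | ⟨q, y, hy, h1, h2⟩
      · exact Or.inl (by rw [h])
      · refine Or.inr ⟨q, y, hy, ?_, ?_⟩
        · rw [h1, iterate_succ_apply']
        · rw [h2, iterate_succ_apply']

lemma exists_val {Y P E : Type} [MetricSpace Y] [CompactSpace Y] [TopologicalSpace E]
    [DiscreteTopology E] (g : Y → Y) (hg : Continuous g) (τ : P ≃ P) (pt : P → Y)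
    (κ : E → P → (ℕ → Bool) → Y) (hκc : ∀ c p, Continuous (κ c p))
    (K : P → Set Y) (hpt : ∀ p, pt p ∈ K p)
    (hκ : ∀ c p w, κ c p w ∈ K p) (hgK : ∀ p, ∀ y ∈ K p, g y ∈ K (τ p))
    (hgpt : ∀ p, g (pt p) = pt (τ p))
    (hunif : ∀ ε > 0, ∃ N, ∀ m ≥ N, ∀ p, ∀ y ∈ K p, dist (g^[m] y) (g^[m] (pt p)) < ε) :
    ∃ W : (ℕ → E ⊕ Bool) → P → (ℕ → Bool) → Y,
      (∀ p, Continuous (fun t : (ℕ → E ⊕ Bool) × (ℕ → Bool) => W t.1 p t.2)) ∧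
      (∀ c o p w, W (consSeq (Sum.inl c) o) (τ p) w = g (κ c p w)) ∧
      (∀ b o p w, W (consSeq (Sum.inr b) o) (τ p) w = g (W o p (consSeq b w))) := by
  have hclose : ∀ ε > 0, ∃ N, ∀ m ≥ N, ∀ n ≥ m, ∀ o p w,
      dist (approxVal g τ pt κ n o p w) (approxVal g τ pt κ m o p w) < ε := by
    intro ε hε
    obtain ⟨N, hN⟩ := hunif ε hε
    refine ⟨N, fun m hm n hn o p w => ?_⟩
    obtain ⟨k, rfl⟩ := Nat.exists_eq_add_of_le hn
    rcases approxVal_close g τ pt κ K hpt hκ hgK hgpt m k o p w with h | ⟨q, y, hy, h1, h2⟩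
    · rw [h, dist_self]; exact hε
    · rw [h1, h2]; exact hN m hm q y hy
  have hlim : ∀ o p w, ∃ x, Filter.Tendsto (fun m => approxVal g τ pt κ m o p w)
      Filter.atTop (𝓝 x) := by
    intro o p w
    refine cauchySeq_tendsto_of_complete (Metric.cauchySeq_iff'.2 fun ε hε => ?_)
    obtain ⟨N, hN⟩ := hclose ε hε
    exact ⟨N, fun n hn => hN N le_rfl n hn o p w⟩
  choose W hW using hlim
  refine ⟨W, ?_, ?_, ?_⟩
  · intro p
    have hu : TendstoUniformly
        (fun m => fun t : (ℕ → E ⊕ Bool) × (ℕ → Bool) => approxVal g τ pt κ m t.1 p t.2)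
        (fun t => W t.1 p t.2) Filter.atTop := by
      rw [Metric.tendstoUniformly_iff]
      intro ε hε
      obtain ⟨N, hN⟩ := hclose (ε / 2) (by positivity)
      filter_upwards [Filter.eventually_ge_atTop N] with m hm t
      have h1 : Filter.Tendsto (fun n => dist (approxVal g τ pt κ n t.1 p t.2)
          (approxVal g τ pt κ m t.1 p t.2)) Filter.atTop
          (𝓝 (dist (W t.1 p t.2) (approxVal g τ pt κ m t.1 p t.2))) :=
        (hW t.1 p t.2).dist tendsto_const_nhds
      have h2 : dist (W t.1 p t.2) (approxVal g τ pt κ m t.1 p t.2) ≤ ε / 2 := by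
        refine le_of_tendsto h1 ?_
        filter_upwards [Filter.eventually_ge_atTop m] with n hn
        exact (hN m hm n hn _ _ _).le
      linarith
    exact hu.continuous (Filter.Frequently.of_forall fun m =>
      approxVal_continuous g hg τ pt κ hκc m p)
  · intro c o p w
    refine tendsto_nhds_unique ((hW (consSeq (Sum.inl c) o) (τ p) w).comp
      (Filter.tendsto_add_atTop_nat 1)) ?_
    refine tendsto_const_nhds.congr fun m => ?_
    simp [approxVal, consSeq]
  · intro b o p w
    refine tendsto_nhds_unique ((hW (consSeq (Sum.inr b) o) (τ p) w).comp
      (Filter.tendsto_add_atTop_nat 1)) ?_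
    refine (((hg.tendsto _).comp (hW o p (consSeq b w)))).congr fun m => ?_
    simp [approxVal, consSeq]

lemma exists_cantor_code {Y : Type} [MetricSpace Y] [CompactSpace Y] (L : Set Y)
    (hL : IsClosed L) (hne : L.Nonempty) :
    ∃ κ : (ℕ → Bool) → Y, Continuous κ ∧ range κ = L := by
  have : Nonempty L := hne.to_subtype
  have : CompactSpace L := isCompact_iff_compactSpace.1 hL.isCompact
  obtain ⟨f, hf, hs⟩ := exists_nat_bool_continuous_surjective_of_compact L
  refine ⟨fun w => (f w : Y), continuous_subtype_val.comp hf, ?_⟩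
  rw [show (fun w => (f w : Y)) = Subtype.val ∘ f from rfl, range_comp, hs.range_eq]
  simp

/-- The bits of an input tape. -/
def bitsOf {D : Type} (i : ℕ → D × Bool) : ℕ → Bool := fun n => (i n).2

lemma consSeq_bitsOf {D : Type} (i : ℕ → D × Bool) :
    consSeq (i 0).2 (bitsOf (fun n => i (n + 1))) = bitsOf i := by
  funext n
  cases n <;> rfl

/-- Transition target in the cell part. -/
def cellTarget {C P : Type} (c : C) : C ⊕ P → C ⊕ (Option C × P) ⊕ (P × Bool)
  | Sum.inl c' => Sum.inl c'
  | Sum.inr p => Sum.inr (Sum.inl (some c, p))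

/-- Valid transitions from a cell. -/
def validMove {Y C P : Type} (g : Y → Y) (J : C → Set Y) (K : P → Set Y) (c : C) : C ⊕ P → Prop
  | Sum.inl c' => J c' ⊆ g '' J c
  | Sum.inr p => (g '' J c ∩ K p).Nonempty

open Classical in
/-- The transition function of the automaton. -/
noncomputable def markovA {Y C P : Type} (g : Y → Y) (J : C → Set Y) (K : P → Set Y) (τ : P ≃ P)
    (dft : C → C ⊕ P) :
    (C ⊕ (Option C × P) ⊕ (P × Bool)) × ((C ⊕ P) × Bool) → C ⊕ (Option C × P) ⊕ (P × Bool)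
  | (Sum.inl c, (r, _)) =>
      if validMove g J K c r then cellTarget c r else cellTarget c (dft c)
  | (Sum.inr (Sum.inl (_, p)), (_, b)) => Sum.inr (Sum.inr (τ p, b))
  | (Sum.inr (Sum.inr (p, _)), (_, b)) => Sum.inr (Sum.inr (τ p, b))

/-- The output function of the automaton. -/
def markovB {C P : Type} : C ⊕ (Option C × P) ⊕ (P × Bool) → Option C ⊕ Bool
  | Sum.inl _ => Sum.inr false
  | Sum.inr (Sum.inl (c, _)) => Sum.inl c
  | Sum.inr (Sum.inr (_, b)) => Sum.inr b

/-- The set of values compatible with a configuration. -/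
def markovZ {Y C P : Type} (J : C → Set Y) (κ : Option C → P → (ℕ → Bool) → Y)
    (W : (ℕ → Option C ⊕ Bool) → P → (ℕ → Bool) → Y)
    (o : ℕ → Option C ⊕ Bool) (i : ℕ → (C ⊕ P) × Bool) :
    C ⊕ (Option C × P) ⊕ (P × Bool) → Set Y
  | Sum.inl c => J c
  | Sum.inr (Sum.inl (c, p)) => {κ c p (bitsOf i)}
  | Sum.inr (Sum.inr (p, b)) => {W o p (consSeq b (bitsOf i))}

theorem markov_factor {Y : Type} [MetricSpace Y] [CompactSpace Y] (g : Y → Y) (hg : Continuous g)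
    {P C : Type} [Finite P] [Nonempty P] [Finite C] (τ : P ≃ P) (K : P → Set Y)
    (hKc : ∀ p, IsClosed (K p)) (pt : P → Y) (hpt : ∀ p, pt p ∈ K p)
    (hgpt : ∀ p, g (pt p) = pt (τ p)) (hgK : ∀ p, ∀ y ∈ K p, g y ∈ K (τ p))
    (hunif : ∀ ε > 0, ∃ N, ∀ m ≥ N, ∀ p, ∀ y ∈ K p, dist (g^[m] y) (g^[m] (pt p)) < ε)
    (J : C → Set Y) (hJc : ∀ c, IsClosed (J c)) (hJne : ∀ c, (J c).Nonempty)
    (hinj : ∀ c, InjOn g (J c))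
    (hcov2 : ∀ c, ∀ x ∈ J c, (∃ p, g x ∈ K p) ∨ ∃ c', J c' ⊆ g '' J c ∧ g x ∈ J c')
    (hcov1 : ∀ x, (∃ p, x ∈ K p) ∨ ∃ c, x ∈ J c)
    (hitin : ∀ x x', ∀ c : ℕ → C, (∀ n, g^[n] x ∈ J (c n)) → (∀ n, g^[n] x' ∈ J (c n)) → x = x')
    (henter : ∀ x, ∃ n p, g^[n] x ∈ K p) : IsFactorOfFiniteAutomaton g := by
  classical
  -- topologies
  let _ : TopologicalSpace C := ⊥
  have : DiscreteTopology C := ⟨rfl⟩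
  let _ : TopologicalSpace P := ⊥
  have : DiscreteTopology P := ⟨rfl⟩
  let _ : TopologicalSpace (Option C) := ⊥
  have : DiscreteTopology (Option C) := ⟨rfl⟩
  -- Cantor codes
  have hκex : ∀ c : Option C, ∀ p, ∃ κ : (ℕ → Bool) → Y, Continuous κ ∧ (∀ w, κ w ∈ K p) ∧
      (c = none → range κ = K p) ∧
      (∀ d, c = some d → (g '' J d ∩ K p).Nonempty → range κ = g '' J d ∩ K p) := by
    intro c p
    rcases c with _ | d
    · obtain ⟨κ, h1, h2⟩ := exists_cantor_code (K p) (hKc p) ⟨_, hpt p⟩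
      exact ⟨κ, h1, fun w => h2 ▸ mem_range_self w, fun _ => h2, by simp⟩
    · by_cases h : (g '' J d ∩ K p).Nonempty
      · obtain ⟨κ, h1, h2⟩ := exists_cantor_code (g '' J d ∩ K p)
          ((((hJc d).isCompact.image hg).isClosed).inter (hKc p)) h
        refine ⟨κ, h1, fun w => ?_, by simp, ?_⟩
        · have : κ w ∈ g '' J d ∩ K p := h2 ▸ mem_range_self w
          exact this.2
        · rintro d' hd' -
          obtain rfl := Option.some_injective _ hd'
          exact h2
      · refine ⟨fun _ => pt p, continuous_const, fun _ => hpt p, by simp, ?_⟩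
        rintro d' hd' hne
        obtain rfl := Option.some_injective _ hd'
        exact absurd hne h
  choose κ hκc hκK hκn hκs using hκex
  obtain ⟨W, hWc, hW1, hW2⟩ := exists_val g hg τ pt κ hκc K hpt hκK hgK hgpt hunif
  -- default moves
  have hdft : ∀ c, ∃ r, validMove g J K c r := by
    intro c
    obtain ⟨x, hx⟩ := hJne c
    rcases hcov2 c x hx with ⟨p, hp⟩ | ⟨c', h1, -⟩
    · exact ⟨Sum.inr p, ⟨g x, mem_image_of_mem _ hx, hp⟩⟩
    · exact ⟨Sum.inl c', h1⟩
  choose dft hdft using hdft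
  let fA := markovA g J K τ dft
  let fB : C ⊕ (Option C × P) ⊕ (P × Bool) → Option C ⊕ Bool := markovB
  let Z : (ℕ → Option C ⊕ Bool) × (C ⊕ (Option C × P) ⊕ (P × Bool)) × (ℕ → (C ⊕ P) × Bool) →
    Set Y := fun t => markovZ J κ W t.1 t.2.2 t.2.1
  have hbits : Continuous (fun i : ℕ → (C ⊕ P) × Bool => bitsOf i) :=
    continuous_pi fun n => continuous_snd.comp (continuous_apply n)
  -- moves from a cell
  have hmove : ∀ c (a : (C ⊕ P) × Bool), ∃ r, validMove g J K c r ∧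
      fA (Sum.inl c, a) = cellTarget c r := by
    rintro c ⟨r, b⟩
    by_cases h : validMove g J K c r
    · exact ⟨r, h, by simp [fA, markovA, h]⟩
    · exact ⟨dft c, hdft c, by simp [fA, markovA, h]⟩
  -- values in the attracting part
  have hstepK : ∀ o s i, ∃ y, Z (o, Sum.inr s, i) = {y} ∧
      Z (triStep fA fB (o, Sum.inr s, i)) = {g y} := by
    rintro o (⟨c, p⟩ | ⟨p, b⟩) i
    · refine ⟨_, rfl, ?_⟩
      simp only [Z, triStep, fA, fB, markovA, markovB, markovZ, hW1, consSeq_bitsOf]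
    · refine ⟨_, rfl, ?_⟩
      simp only [Z, triStep, fA, fB, markovA, markovB, markovZ, hW2, consSeq_bitsOf]
  have hcl : IsClosed {q : ((ℕ → Option C ⊕ Bool) × (C ⊕ (Option C × P) ⊕ (P × Bool)) ×
        (ℕ → (C ⊕ P) × Bool)) × Y | q.2 ∈ Z q.1} := by
    have heq : {q : ((ℕ → Option C ⊕ Bool) × (C ⊕ (Option C × P) ⊕ (P × Bool)) ×
        (ℕ → (C ⊕ P) × Bool)) × Y | q.2 ∈ Z q.1} =
        ⋂ s, ({q | q.1.2.1 = s}ᶜ ∪ {q | q.2 ∈ markovZ J κ W q.1.1 q.1.2.2 s}) := by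
      ext q
      simp only [mem_iInter, mem_union, mem_compl_iff]
      constructor
      · intro h s
        by_cases hs : q.1.2.1 = s
        · right; subst hs; exact h
        · left; exact hs
      · intro h
        rcases h q.1.2.1 with h | h
        · exact absurd rfl h
        · exact h
    rw [heq]
    refine isClosed_iInter fun s => IsClosed.union ?_ ?_
    · have hcs : Continuous (fun q : ((ℕ → Option C ⊕ Bool) × (C ⊕ (Option C × P) ⊕ (P × Bool)) ×
        (ℕ → (C ⊕ P) × Bool)) × Y => q.1.2.1) :=
        continuous_fst.comp (continuous_snd.comp continuous_fst)
      exact ((isOpen_discrete {s}).preimage hcs).isClosed_compl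
    · rcases s with c | ⟨c, p⟩ | ⟨p, b⟩
      · exact (hJc c).preimage continuous_snd
      · refine isClosed_eq continuous_snd ?_
        exact (hκc c p).comp (hbits.comp (continuous_snd.comp (continuous_snd.comp continuous_fst)))
      · refine isClosed_eq continuous_snd ?_
        refine (hWc p).comp (Continuous.prodMk (continuous_fst.comp continuous_fst) ?_)
        exact continuous_consSeq continuous_const
          (hbits.comp (continuous_snd.comp (continuous_snd.comp continuous_fst)))
  have hne : ∀ u, (Z u).Nonempty := by
    rintro ⟨o, c | ⟨c, p⟩ | ⟨p, b⟩, i⟩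
    · exact hJne c
    · exact singleton_nonempty _
    · exact singleton_nonempty _
  have hmk : ∀ u, Z (triStep fA fB u) ⊆ g '' Z u := by
    rintro ⟨o, c | s, i⟩
    · obtain ⟨r, hr, hr2⟩ := hmove c (i 0)
      have hst : triStep fA fB (o, Sum.inl c, i) =
          (consSeq (Sum.inr false) o, cellTarget c r, fun n => i (n + 1)) := by
        unfold triStep
        simp only [hr2]
        rfl
      rw [hst]
      rcases r with c' | p
      · exact hr
      · have h1 := hκs (some c) p c rfl hr
        intro y hy
        have hy' : y ∈ range (κ (some c) p) := ⟨_, (mem_singleton_iff.1 hy).symm⟩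
        rw [h1] at hy'
        exact hy'.1
    · obtain ⟨y, h1, h2⟩ := hstepK o s i
      rw [h1, h2, image_singleton]
  have huq : ∀ u x x', (∀ n, g^[n] x ∈ Z ((triStep fA fB)^[n] u)) →
      (∀ n, g^[n] x' ∈ Z ((triStep fA fB)^[n] u)) → x = x' := by
    intro u x x' hx hx'
    by_cases hall : ∀ n, ∃ c, ((triStep fA fB)^[n] u).2.1 = Sum.inl c
    · choose c hc using hall
      refine hitin x x' c (fun n => ?_) (fun n => ?_)
      · have := hx n
        simp only [Z, hc] at this
        exact this
      · have := hx' n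
        simp only [Z, hc] at this
        exact this
    · push Not at hall
      obtain ⟨n, hn⟩ := hall
      induction n generalizing u x x' with
      | zero =>
        obtain ⟨o, c | s, i⟩ := u
        · exact absurd rfl (hn c)
        · obtain ⟨y, h1, -⟩ := hstepK o s i
          have a1 := hx 0
          have a2 := hx' 0
          simp only [iterate_zero, id_eq, h1, mem_singleton_iff] at a1 a2
          rw [a1, a2]
      | succ n ih =>
        obtain ⟨o, c | s, i⟩ := u
        · refine hinj c (hx 0) (hx' 0) ?_
          refine ih (triStep fA fB (o, Sum.inl c, i)) (g x) (g x') (fun k => ?_) (fun k => ?_) ?_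
          · have := hx (k + 1)
            rwa [iterate_succ_apply, iterate_succ_apply] at this
          · have := hx' (k + 1)
            rwa [iterate_succ_apply, iterate_succ_apply] at this
          · intro c'
            have := hn c'
            rwa [iterate_succ_apply] at this
        · obtain ⟨y, h1, -⟩ := hstepK o s i
          have a1 := hx 0
          have a2 := hx' 0
          simp only [iterate_zero, id_eq, h1, mem_singleton_iff] at a1 a2
          rw [a1, a2]
  obtain ⟨ψ, hψc, hψg, hψu⟩ := closed_relation_factor (triStep fA fB)
    (triStep_continuous fA fB) g hg Z hcl hne hmk huq
  -- surjectivity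
  refine factor_of_tri g fA fB ψ hψc ?_ hψg
  -- orbits in the attracting part
  have hKrel : ∀ o s i x, x ∈ Z (o, Sum.inr s, i) →
      ∀ n, g^[n] x ∈ Z ((triStep fA fB)^[n] (o, Sum.inr s, i)) := by
    intro o s i x hx n
    induction n generalizing o s i x with
    | zero => exact hx
    | succ n ih =>
      rw [iterate_succ_apply, iterate_succ_apply]
      obtain ⟨y, h1, h2⟩ := hstepK o s i
      have hxy : x = y := by rw [h1] at hx; exact hx
      have hstate : ∃ s', (triStep fA fB (o, Sum.inr s, i)).2.1 = Sum.inr s' := by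
        rcases s with ⟨c, p⟩ | ⟨p, b⟩
        · exact ⟨_, rfl⟩
        · exact ⟨_, rfl⟩
      obtain ⟨s', hs'⟩ := hstate
      have heq : triStep fA fB (o, Sum.inr s, i) = ((triStep fA fB (o, Sum.inr s, i)).1,
        Sum.inr s', (triStep fA fB (o, Sum.inr s, i)).2.2) := by
        rw [← hs']
      rw [heq]
      apply ih
      rw [← heq, h2, hxy]
      rfl
  have hcell : ∀ N c x, x ∈ J c → (∃ p, g^[N] x ∈ K p) →
      ∃ i, ∀ o n, g^[n] x ∈ Z ((triStep fA fB)^[n] (o, Sum.inl c, i)) := by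
    have hbase : ∀ c x, x ∈ J c → (∃ p, g x ∈ K p) →
        ∃ i, ∀ o n, g^[n] x ∈ Z ((triStep fA fB)^[n] (o, Sum.inl c, i)) := by
      rintro c x hx ⟨p, hp⟩
      have hne : (g '' J c ∩ K p).Nonempty := ⟨g x, mem_image_of_mem _ hx, hp⟩
      have hr := hκs (some c) p c rfl hne
      obtain ⟨w, hw⟩ : g x ∈ range (κ (some c) p) := by
        rw [hr]; exact ⟨mem_image_of_mem _ hx, hp⟩
      refine ⟨consSeq (Sum.inr p, false) (fun n => (Sum.inr p, w n)), fun o n => ?_⟩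
      cases n with
      | zero => exact hx
      | succ n =>
        rw [iterate_succ_apply, iterate_succ_apply]
        have hst : triStep fA fB (o, Sum.inl c,
            consSeq (Sum.inr p, false) (fun n => (Sum.inr p, w n))) =
            (consSeq (Sum.inr false) o, Sum.inr (Sum.inl (some c, p)),
              fun n => (Sum.inr p, w n)) := by
          have hv : validMove g J K c (Sum.inr p) := hne
          simp [triStep, fA, fB, markovA, markovB, consSeq, hv, cellTarget]
        rw [hst]
        apply hKrel
        exact hw.symm
    intro N
    induction N with
    | zero =>
      rintro c x hx ⟨p, hp⟩
      exact hbase c x hx ⟨_, hgK p x hp⟩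
    | succ N ih =>
      rintro c x hx ⟨p, hp⟩
      rcases hcov2 c x hx with hq | ⟨c', h1, h2⟩
      · exact hbase c x hx hq
      · obtain ⟨i, hi⟩ := ih c' (g x) h2 ⟨p, hp⟩
        refine ⟨consSeq (Sum.inl c', false) i, fun o n => ?_⟩
        cases n with
        | zero => exact hx
        | succ n =>
          rw [iterate_succ_apply, iterate_succ_apply]
          have hst : triStep fA fB (o, Sum.inl c, consSeq (Sum.inl c', false) i) =
              (consSeq (Sum.inr false) o, Sum.inl c', i) := by
            have hv : validMove g J K c (Sum.inl c') := h1
            simp [triStep, fA, fB, markovA, markovB, consSeq, hv, cellTarget]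
          rw [hst]
          exact hi _ n
  intro x
  rcases hcov1 x with ⟨p, hp⟩ | ⟨c, hc⟩
  · have hr := hκn none p rfl
    obtain ⟨w, hw⟩ : x ∈ range (κ none p) := by rw [hr]; exact hp
    exact ⟨(fun _ => Sum.inr false, Sum.inr (Sum.inl (none, p)), fun n => (Sum.inr p, w n)),
      hψu _ x (hKrel _ _ _ _ hw.symm)⟩
  · obtain ⟨N, hN⟩ := henter x
    obtain ⟨i, hi⟩ := hcell N c x hc hN
    exact ⟨(fun _ => Sum.inr false, Sum.inl c, i), hψu _ x (hi _)⟩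

/-! ### Cells on the interval -/

/-- `(a, b)` is a gap of the cut set `S` which avoids the attracting intervals. -/
def IsCell {P : Type} (S : Set ℝ) (l r : P → ℝ) (a b : ℝ) : Prop :=
  a ∈ S ∧ b ∈ S ∧ a < b ∧ (∀ s ∈ S, a < s → b ≤ s) ∧
    ∀ p, ∀ z ∈ Icc (l p) (r p), ¬ (a < z ∧ z < b)

lemma exists_cell {P : Type} (S : Set ℝ) (hSf : S.Finite) (l r : P → ℝ)
    (hl : ∀ p, l p ∈ S) (hr : ∀ p, r p ∈ S) (h1 : (-1 : ℝ) ∈ S) (h2 : (1 : ℝ) ∈ S)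
    (u v y : ℝ) (huv : u < v) (hu1 : -1 ≤ u) (hv1 : v ≤ 1)
    (hu : u ∈ S ∨ ∃ p, u ∈ Icc (l p) (r p)) (hv : v ∈ S ∨ ∃ p, v ∈ Icc (l p) (r p))
    (hy : y ∈ Icc u v) (hyK : ∀ p, y ∉ Icc (l p) (r p)) :
    ∃ a b, IsCell S l r a b ∧ y ∈ Icc a b ∧ u ≤ a ∧ b ≤ v := by
  -- a generic finisher
  have fin : ∀ a b, a ∈ S → b ∈ S → a < b → (∀ s ∈ S, a < s → b ≤ s) → y ∈ Icc a b →
      (u ∈ S → u ≤ a) → (v ∈ S → b ≤ v) →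
      ∃ a b, IsCell S l r a b ∧ y ∈ Icc a b ∧ u ≤ a ∧ b ≤ v := by
    intro a b ha hb hab hgap hyab hua hvb
    have hK : ∀ p, ∀ z ∈ Icc (l p) (r p), ¬ (a < z ∧ z < b) := by
      rintro p z ⟨hz1, hz2⟩ ⟨hz3, hz4⟩
      refine hyK p ⟨?_, ?_⟩
      · by_contra hc
        have : a < l p := by
          have := hyab.1
          push Not at hc
          linarith
        have := hgap _ (hl p) this
        linarith
      · have : b ≤ r p := hgap _ (hr p) (by linarith)
        linarith [hyab.2]
    refine ⟨a, b, ⟨ha, hb, hab, hgap, hK⟩, hyab, ?_, ?_⟩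
    · rcases hu with hu | ⟨p, hp⟩
      · exact hua hu
      · by_contra hc
        push Not at hc
        have hne : u ≠ y := by rintro rfl; exact hyK p hp
        have : u < y := lt_of_le_of_ne hy.1 hne
        exact hK p u hp ⟨hc, by linarith [hyab.2]⟩
    · rcases hv with hv | ⟨p, hp⟩
      · exact hvb hv
      · by_contra hc
        push Not at hc
        have hne : y ≠ v := by rintro rfl; exact hyK p hp
        have : y < v := lt_of_le_of_ne hy.2 hne
        exact hK p v hp ⟨by linarith [hyab.1], hc⟩
  rcases lt_or_eq_of_le hy.2 with hyv | hyv
  · obtain ⟨a, ⟨haS, hay⟩, hamax⟩ := Set.exists_max_image (S ∩ Iic y) id (hSf.inter_of_left _)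
      ⟨-1, h1, by show (-1 : ℝ) ≤ y; linarith [hy.1]⟩
    obtain ⟨b, ⟨hbS, hby⟩, hbmin⟩ := Set.exists_min_image (S ∩ Ioi y) id (hSf.inter_of_left _)
      ⟨1, h2, by show y < (1 : ℝ); linarith⟩
    have hay' : a ≤ y := hay
    have hby' : y < b := hby
    refine fin a b haS hbS (by linarith) ?_ ⟨hay', hby'.le⟩ ?_ ?_
    · intro s hs has
      by_cases hsy : s ≤ y
      · have : s ≤ a := hamax s ⟨hs, hsy⟩
        linarith
      · exact hbmin s ⟨hs, not_le.1 hsy⟩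
    · intro hu; exact hamax u ⟨hu, hy.1⟩
    · intro hv; exact hbmin v ⟨hv, hyv⟩
  · have huy : u < y := by linarith
    obtain ⟨a, ⟨haS, hay⟩, hamax⟩ := Set.exists_max_image (S ∩ Iio y) id (hSf.inter_of_left _)
      ⟨-1, h1, by show (-1 : ℝ) < y; linarith [hy.1]⟩
    have hyS : y ∈ S := by
      rcases hv with hv | ⟨p, hp⟩
      · rw [hyv]; exact hv
      · rw [← hyv] at hp; exact absurd hp (hyK p)
    have hay' : a < y := hay
    refine fin a y haS hyS hay' ?_ ⟨hay'.le, le_rfl⟩ ?_ ?_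
    · intro s hs has
      by_contra hsy
      have : s ≤ a := hamax s ⟨hs, not_le.1 hsy⟩
      linarith
    · intro hu; exact hamax u ⟨hu, huy⟩
    · intro _; exact hyv.le

lemma interval_factor (G : ℝ → ℝ) (hGc : Continuous G) (hGI : ∀ x, G x ∈ Icc (-1 : ℝ) 1)
    (hmono : StrictMonoOn G (Icc (-1) 0)) (hanti : StrictAntiOn G (Icc 0 1))
    (hm1 : G (-1) = -1) (h1 : G 1 = -1) {P : Type} [Finite P] [Nonempty P] (τ : P ≃ P)
    (l r : P → ℝ) (hl : ∀ p, -1 ≤ l p) (hr : ∀ p, r p ≤ 1) (pt : P → ℝ)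
    (hpt : ∀ p, pt p ∈ Icc (l p) (r p)) (hgpt : ∀ p, G (pt p) = pt (τ p))
    (hgK : ∀ p, ∀ y ∈ Icc (l p) (r p), G y ∈ Icc (l (τ p)) (r (τ p)))
    (hunif : ∀ ε > 0, ∃ N, ∀ m ≥ N, ∀ p, ∀ y ∈ Icc (l p) (r p),
      dist (G^[m] y) (G^[m] (pt p)) < ε)
    (henter : ∀ x ∈ Icc (-1 : ℝ) 1, ∃ n p, G^[n] x ∈ Icc (l p) (r p))
    (gY : Icc (-1 : ℝ) 1 → Icc (-1 : ℝ) 1) (hgY : ∀ y, (gY y : ℝ) = G y) :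
    IsFactorOfFiniteAutomaton gY := by
  have hlr : ∀ p, l p ≤ r p := fun p => (hpt p).1.trans (hpt p).2
  obtain ⟨N, p0, hN⟩ := henter 0 (by norm_num)
  obtain ⟨S, hS⟩ : ∃ S : Set ℝ, S = {-1, 0, 1} ∪ range l ∪ range r ∪ (fun i => G^[i] 0) '' Iic N :=
    ⟨_, rfl⟩
  have hSf : S.Finite := by
    rw [hS]
    exact (((toFinite _).union (finite_range l)).union (finite_range r)).union
      ((finite_Iic N).image _)
  have hSm1 : (-1 : ℝ) ∈ S := by rw [hS]; simp
  have hS0 : (0 : ℝ) ∈ S := by rw [hS]; simp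
  have hS1 : (1 : ℝ) ∈ S := by rw [hS]; simp
  have hSl : ∀ p, l p ∈ S := fun p => by
    rw [hS]; exact Or.inl (Or.inl (Or.inr (mem_range_self p)))
  have hSr : ∀ p, r p ∈ S := fun p => by
    rw [hS]; exact Or.inl (Or.inr (mem_range_self p))
  have hSG : ∀ s ∈ S, G s ∈ S ∨ ∃ p, G s ∈ Icc (l p) (r p) := by
    have horb : ∀ i ≤ N, G (G^[i] 0) ∈ S ∨ ∃ p, G (G^[i] 0) ∈ Icc (l p) (r p) := by
      intro i hi
      rcases Nat.lt_or_ge i N with h | h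
      · left
        rw [← iterate_succ_apply' G, hS]
        exact Or.inr ⟨i + 1, h, rfl⟩
      · right
        obtain rfl : i = N := by omega
        exact ⟨_, hgK _ _ hN⟩
    intro s hs
    rw [hS] at hs
    rcases hs with ((hs | ⟨p, rfl⟩) | ⟨p, rfl⟩) | ⟨i, hi, rfl⟩
    · rcases hs with rfl | rfl | rfl
      · left; rw [hm1]; exact hSm1
      · exact horb 0 (Nat.zero_le _)
      · left; rw [h1]; exact hSm1
    · right; exact ⟨_, hgK p _ ⟨le_rfl, hlr p⟩⟩
    · right; exact ⟨_, hgK p _ ⟨hlr p, le_rfl⟩⟩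
    · exact horb i hi
  have hSI : ∀ s ∈ S, s ∈ Icc (-1 : ℝ) 1 := by
    intro s hs
    rw [hS] at hs
    rcases hs with ((hs | ⟨p, rfl⟩) | ⟨p, rfl⟩) | ⟨i, hi, rfl⟩
    · rcases hs with rfl | rfl | rfl <;> norm_num
    · exact ⟨hl p, (hlr p).trans (hr p)⟩
    · exact ⟨(hl p).trans (hlr p), hr p⟩
    · cases i with
      | zero => simp
      | succ i => 
        simp only [iterate_succ_apply']
        exact hGI _
  -- monotonicity on cells
  have hcellmono : ∀ a b, IsCell S l r a b →
      (StrictMonoOn G (Icc a b) ∨ StrictAntiOn G (Icc a b)) := by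
    rintro a b ⟨ha, hb, hab, hgap, -⟩
    rcases lt_or_ge a 0 with h | h
    · left
      exact hmono.mono (Icc_subset_Icc (hSI a ha).1 (hgap 0 hS0 h))
    · right
      exact hanti.mono (Icc_subset_Icc h (hSI b hb).2)
  let C := {ab : ℝ × ℝ // IsCell S l r ab.1 ab.2}
  have hCf : Finite C := by
    refine Set.Finite.to_subtype ((hSf.prod hSf).subset ?_)
    rintro ⟨a, b⟩ ⟨ha, hb, -⟩
    exact ⟨ha, hb⟩
  have hgYc : Continuous gY := by
    rw [continuous_induced_rng]
    have : (Subtype.val ∘ gY) = fun y : Icc (-1 : ℝ) 1 => G y := by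
      funext y; exact hgY y
    rw [this]
    exact hGc.comp continuous_subtype_val
  have hiter : ∀ n (y : Icc (-1 : ℝ) 1), ((gY^[n] y : Icc (-1 : ℝ) 1) : ℝ) = G^[n] y := by
    intro n
    induction n with
    | zero => intro y; rfl
    | succ n ih => intro y; rw [iterate_succ_apply, iterate_succ_apply, ih, hgY]
  have hptI : ∀ p, pt p ∈ Icc (-1 : ℝ) 1 := fun p =>
    ⟨(hl p).trans (hpt p).1, (hpt p).2.trans (hr p)⟩
  -- images of cells
  have himage : ∀ a b, IsCell S l r a b → ∃ u v, u < v ∧ G '' Icc a b = Icc u v ∧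
      (u ∈ S ∨ ∃ p, u ∈ Icc (l p) (r p)) ∧ (v ∈ S ∨ ∃ p, v ∈ Icc (l p) (r p)) ∧
      -1 ≤ u ∧ v ≤ 1 := by
    intro a b hc
    have hab : a < b := hc.2.2.1
    rcases hcellmono a b hc with h | h
    · refine ⟨G a, G b, h ⟨le_rfl, hab.le⟩ ⟨hab.le, le_rfl⟩ hab, ?_, hSG a hc.1, hSG b hc.2.1,
        (hGI _).1, (hGI _).2⟩
      refine Subset.antisymm ?_ (intermediate_value_Icc hab.le hGc.continuousOn)
      rintro _ ⟨x, hx, rfl⟩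
      exact ⟨h.monotoneOn ⟨le_rfl, hab.le⟩ hx hx.1, h.monotoneOn hx ⟨hab.le, le_rfl⟩ hx.2⟩
    · refine ⟨G b, G a, h ⟨le_rfl, hab.le⟩ ⟨hab.le, le_rfl⟩ hab, ?_, hSG b hc.2.1, hSG a hc.1,
        (hGI _).1, (hGI _).2⟩
      refine Subset.antisymm ?_ (intermediate_value_Icc' hab.le hGc.continuousOn)
      rintro _ ⟨x, hx, rfl⟩
      exact ⟨h.antitoneOn hx ⟨hab.le, le_rfl⟩ hx.2, h.antitoneOn ⟨le_rfl, hab.le⟩ hx hx.1⟩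
  -- strict betweenness
  have hbet : ∀ (x z x' : ℝ) (c : ℕ → C), x < z → z < x' →
      (∀ n, G^[n] x ∈ Icc (c n).1.1 (c n).1.2) → (∀ n, G^[n] x' ∈ Icc (c n).1.1 (c n).1.2) →
      ∀ n, (G^[n] x < G^[n] z ∧ G^[n] z < G^[n] x') ∨
        (G^[n] x' < G^[n] z ∧ G^[n] z < G^[n] x) := by
    intro x z x' c hxz hzx' hx hx' n
    induction n with
    | zero => exact Or.inl ⟨hxz, hzx'⟩
    | succ n ih =>
      simp only [iterate_succ_apply']
      have e1 := hx n
      have e2 := hx' n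
      rcases ih with ⟨i1, i2⟩ | ⟨i1, i2⟩
      · have e3 : G^[n] z ∈ Icc (c n).1.1 (c n).1.2 :=
          ⟨e1.1.trans i1.le, i2.le.trans e2.2⟩
        rcases hcellmono _ _ (c n).2 with h | h
        · exact Or.inl ⟨h e1 e3 i1, h e3 e2 i2⟩
        · exact Or.inr ⟨h e3 e2 i2, h e1 e3 i1⟩
      · have e3 : G^[n] z ∈ Icc (c n).1.1 (c n).1.2 :=
          ⟨e2.1.trans i1.le, i2.le.trans e1.2⟩
        rcases hcellmono _ _ (c n).2 with h | h
        · exact Or.inr ⟨h e2 e3 i1, h e3 e1 i2⟩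
        · exact Or.inl ⟨h e3 e1 i2, h e2 e3 i1⟩
  have hitin : ∀ (x x' : Icc (-1 : ℝ) 1) (c : ℕ → C), x < x' →
      (∀ n, G^[n] x ∈ Icc (c n).1.1 (c n).1.2) → (∀ n, G^[n] x' ∈ Icc (c n).1.1 (c n).1.2) →
      False := by
    intro x x' c hlt hx hx'
    obtain ⟨z, hz1, hz2⟩ := exists_between (show (x : ℝ) < x' from hlt)
    obtain ⟨n, p, hn⟩ := henter z ⟨x.2.1.trans hz1.le, hz2.le.trans x'.2.2⟩
    have hK := (c n).2.2.2.2.2 p _ hn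
    have e1 := hx n
    have e2 := hx' n
    rcases hbet x z x' c hz1 hz2 hx hx' n with ⟨i1, i2⟩ | ⟨i1, i2⟩
    · exact hK ⟨e1.1.trans_lt i1, i2.trans_le e2.2⟩
    · exact hK ⟨e2.1.trans_lt i1, i2.trans_le e1.2⟩
  refine markov_factor gY hgYc τ (fun p => {y | (y : ℝ) ∈ Icc (l p) (r p)})
    (fun p => isClosed_Icc.preimage continuous_subtype_val) (fun p => ⟨pt p, hptI p⟩) hpt
    (fun p => Subtype.ext (by rw [hgY]; exact hgpt p)) ?_ ?_
    (fun c : C => {y | (y : ℝ) ∈ Icc c.1.1 c.1.2})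
    (fun p => isClosed_Icc.preimage continuous_subtype_val) ?_ ?_ ?_ ?_ ?_ ?_
  · intro p y hy
    rw [mem_ofPred_eq]
    rw [hgY]
    exact hgK p y hy
  · intro ε hε
    obtain ⟨M, hM⟩ := hunif ε hε
    refine ⟨M, fun m hm p y hy => ?_⟩
    rw [Subtype.dist_eq, hiter, hiter]
    exact hM m hm p y hy
  · rintro ⟨⟨a, b⟩, hc⟩
    exact ⟨⟨a, hSI a hc.1⟩, le_rfl, hc.2.2.1.le⟩
  · rintro ⟨⟨a, b⟩, hc⟩ x hx y hy hxy
    have hxy' : G x = G y := by rw [← hgY, ← hgY, hxy]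
    apply Subtype.ext
    rcases hcellmono a b hc with h | h
    · exact h.injOn hx hy hxy'
    · exact h.injOn hx hy hxy'
  · rintro ⟨⟨a, b⟩, hc⟩ x hx
    by_cases hK : ∃ p, G x ∈ Icc (l p) (r p)
    · left
      obtain ⟨p, hp⟩ := hK
      refine ⟨p, ?_⟩
      rw [mem_ofPred_eq]
      rw [hgY]; exact hp
    · right
      push Not at hK
      obtain ⟨u, v, huv, him, hu, hv, hu1, hv1⟩ := himage a b hc
      have hGx : G x ∈ Icc u v := him ▸ mem_image_of_mem G hx
      obtain ⟨a', b', hc', hy', hua, hbv⟩ := exists_cell S hSf l r hSl hSr hSm1 hS1 u v (G x)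
        huv hu1 hv1 hu hv hGx hK
      refine ⟨⟨(a', b'), hc'⟩, ?_, ?_⟩
      · rintro y ⟨hy1, hy2⟩
        have : (y : ℝ) ∈ G '' Icc a b := by
          rw [him]; exact ⟨hua.trans hy1, hy2.trans hbv⟩
        obtain ⟨t, ht, hty⟩ := this
        refine ⟨⟨t, (hSI a hc.1).1.trans ht.1, ht.2.trans (hSI b hc.2.1).2⟩, ht, ?_⟩
        apply Subtype.ext
        rw [hgY]; exact hty
      · rw [mem_ofPred_eq]
        rw [hgY]; exact hy'
  · intro x
    by_cases hK : ∃ p, (x : ℝ) ∈ Icc (l p) (r p)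
    · exact Or.inl hK
    · right
      push Not at hK
      obtain ⟨a', b', hc', hy', -, -⟩ := exists_cell S hSf l r hSl hSr hSm1 hS1 (-1) 1 x
        (by norm_num) le_rfl le_rfl (Or.inl hSm1) (Or.inl hS1) x.2 hK
      exact ⟨⟨(a', b'), hc'⟩, hy'⟩
  · intro x x' c hx hx'
    have e1 : ∀ n, G^[n] x ∈ Icc (c n).1.1 (c n).1.2 := fun n => by
      rw [← hiter]; exact hx n
    have e2 : ∀ n, G^[n] x' ∈ Icc (c n).1.1 (c n).1.2 := fun n => by
      rw [← hiter]; exact hx' n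
    rcases lt_trichotomy x x' with h | h | h
    · exact (hitin x x' c h e1 e2).elim
    · exact h
    · exact (hitin x' x c h e2 e1).elim
  · intro x
    obtain ⟨n, p, h⟩ := henter x x.2
    refine ⟨n, p, ?_⟩
    rw [mem_ofPred_eq]
    rw [hiter]; exact h

/-! ### Convergence of orbits (no nontrivial periodic points) -/

lemma coppel_up (f : ℝ → ℝ) (hf : Continuous f) (a b : ℝ) (hI : ∀ x, f x ∈ Icc a b)
    (hfix : {x | f x = x}.Finite) (hper : ∀ x n, 0 < n → f^[n] x = x → f x = x)
    (x : ℝ) (hx : x < f x) (n : ℕ) (hn : 0 < n) : x < f^[n] x := by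
  by_contra hcon
  push Not at hcon
  have hlt : f^[n] x < x := lt_of_le_of_ne hcon fun h => by
    have := hper x n hn h
    linarith
  have hfn : Continuous (f^[n]) := hf.iterate n
  have hnI : ∀ t, f^[n] t ∈ Icc a b := by
    intro t
    obtain ⟨m, rfl⟩ : ∃ m, n = m + 1 := ⟨n - 1, by omega⟩
    rw [iterate_succ_apply']
    exact hI _
  -- periodic points between
  have hbetween : ∀ t, t < x → t < f^[n] t → ∃ z, t < z ∧ z < x ∧ f z = z := by
    intro t htx ht
    have h0 : (0 : ℝ) ∈ Icc (f^[n] x - x) (f^[n] t - t) := ⟨by linarith, by linarith⟩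
    obtain ⟨z, hz, hz0⟩ := intermediate_value_Icc' htx.le
      ((hfn.sub continuous_id).continuousOn) h0
    have hz0' : f^[n] z - z = 0 := hz0
    have hz1 : f^[n] z = z := by linarith
    have hz2 := hper z n hn hz1
    refine ⟨z, lt_of_le_of_ne hz.1 ?_, lt_of_le_of_ne hz.2 ?_, hz2⟩
    · rintro rfl; linarith
    · rintro rfl; linarith
  have hne : ({y | f y = y} ∩ Iio x).Nonempty := by
    obtain ⟨z, -, h2, h3⟩ := hbetween (min x a - 1) (by linarith [min_le_left x a])
      (by linarith [min_le_right x a, (hnI (min x a - 1)).1])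
    exact ⟨z, h3, h2⟩
  obtain ⟨y, ⟨hy1, hyx⟩, hymax⟩ := Set.exists_max_image ({y | f y = y} ∩ Iio x) id
    (hfix.inter_of_left _) hne
  have hy1' : f y = y := hy1
  have hyx' : y < x := hyx
  have hup : ∀ t, y < t → t ≤ x → t < f t := by
    intro t hyt htx
    by_contra hc
    push Not at hc
    have h0 : (0 : ℝ) ∈ Icc (f t - t) (f x - x) := ⟨by linarith, by linarith⟩
    obtain ⟨z, hz, hz0⟩ := intermediate_value_Icc htx ((hf.sub continuous_id).continuousOn) h0
    have hz0' : f z - z = 0 := hz0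
    have hzx : z < x := lt_of_le_of_ne hz.2 (by rintro rfl; linarith)
    have : z ≤ y := hymax z ⟨by show f z = z; linarith, hzx⟩
    linarith [hz.1]
  have hev : ∀ᶠ t in 𝓝[>] y, ∀ i ∈ Finset.range (n + 1), f^[i] t < x := by
    rw [Filter.eventually_all_finset]
    intro i _
    have hi : Filter.Tendsto (f^[i]) (𝓝[>] y) (𝓝 (f^[i] y)) :=
      ((hf.iterate i).tendsto y).mono_left nhdsWithin_le_nhds
    have hyi : f^[i] y = y := iterate_fixed hy1' i
    rw [hyi] at hi
    exact hi.eventually (gt_mem_nhds hyx')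
  obtain ⟨t, ht, hty⟩ := (hev.and self_mem_nhdsWithin).exists
  have hty' : y < t := hty
  have hinc : ∀ i ≤ n, t ≤ f^[i] t ∧ (0 < i → t < f^[i] t) := by
    intro i
    induction i with
    | zero => intro _; exact ⟨le_rfl, fun h => absurd h (lt_irrefl _)⟩
    | succ i ih =>
      intro hi
      have h1 := (ih (by omega)).1
      have h2 := ht i (Finset.mem_range.2 (by omega))
      have h3 := hup (f^[i] t) (by linarith) h2.le
      rw [iterate_succ_apply']
      exact ⟨by linarith, fun _ => by linarith⟩
  have htx : t < x := ht 0 (Finset.mem_range.2 (by omega))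
  obtain ⟨z, h1, h2, h3⟩ := hbetween t htx ((hinc n le_rfl).2 hn)
  have : z ≤ y := hymax z ⟨h3, h2⟩
  linarith

lemma neg_conj_iterate (f : ℝ → ℝ) (n : ℕ) (x : ℝ) :
    (fun t => -f (-t))^[n] x = -(f^[n] (-x)) := by
  induction n generalizing x with
  | zero => simp
  | succ n ih => rw [iterate_succ_apply, iterate_succ_apply, ih]; simp

lemma coppel_down (f : ℝ → ℝ) (hf : Continuous f) (a b : ℝ) (hI : ∀ x, f x ∈ Icc a b)
    (hfix : {x | f x = x}.Finite) (hper : ∀ x n, 0 < n → f^[n] x = x → f x = x)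
    (x : ℝ) (hx : f x < x) (n : ℕ) (hn : 0 < n) : f^[n] x < x := by
  have := coppel_up (fun t => -f (-t)) (by fun_prop) (-b) (-a)
    (fun t => ⟨by linarith [(hI (-t)).2], by linarith [(hI (-t)).1]⟩) ?_ ?_ (-x)
    (by simp only [neg_neg]; linarith) n hn
  · rw [neg_conj_iterate, neg_neg] at this
    linarith
  · refine (hfix.image (fun t => -t)).subset ?_
    intro t ht
    have ht' : -f (-t) = t := ht
    exact ⟨-t, by show f (-t) = -t; linarith, by simp⟩
  · intro t m hm ht
    rw [neg_conj_iterate] at ht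
    have := hper (-t) m hm (by linarith)
    show -f (-t) = t
    linarith

lemma orbit_converges (f : ℝ → ℝ) (hf : Continuous f) (a b : ℝ) (hI : ∀ x, f x ∈ Icc a b)
    (hfix : {x | f x = x}.Finite) (hper : ∀ x n, 0 < n → f^[n] x = x → f x = x) (x : ℝ) :
    ∃ p, f p = p ∧ Filter.Tendsto (fun n => f^[n] x) Filter.atTop (𝓝 p) := by
  -- it suffices to converge
  suffices h : ∃ p, Filter.Tendsto (fun n => f^[n] x) Filter.atTop (𝓝 p) by
    obtain ⟨p, hp⟩ := h
    refine ⟨p, ?_, hp⟩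
    exact isFixedPt_of_tendsto_iterate hp hf.continuousAt
  by_cases hst : ∃ n, f^[n + 1] x = f^[n] x
  · obtain ⟨n, hn⟩ := hst
    refine ⟨f^[n] x, tendsto_atTop_of_eventually_const (i₀ := n) fun m hm => ?_⟩
    obtain ⟨k, rfl⟩ := Nat.exists_eq_add_of_le hm
    rw [add_comm, iterate_add_apply]
    rw [iterate_succ_apply'] at hn
    exact iterate_fixed hn k
  push Not at hst
  have hU : ∀ n, f^[n] x < f^[n + 1] x → ∀ m, n < m → f^[n] x < f^[m] x := by
    intro n hn m hm
    obtain ⟨k, rfl⟩ := Nat.exists_eq_add_of_le hm.le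
    rw [add_comm n k, iterate_add_apply]
    rw [iterate_succ_apply'] at hn
    exact coppel_up f hf a b hI hfix hper _ hn k (by omega)
  have hD : ∀ n, ¬ f^[n] x < f^[n + 1] x → ∀ m, n < m → f^[m] x < f^[n] x := by
    intro n hn m hm
    have hn' : f^[n + 1] x < f^[n] x := lt_of_le_of_ne (not_lt.1 hn) (hst n)
    obtain ⟨k, rfl⟩ := Nat.exists_eq_add_of_le hm.le
    rw [add_comm n k, iterate_add_apply]
    rw [iterate_succ_apply'] at hn'
    exact coppel_down f hf a b hI hfix hper _ hn' k (by omega)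
  have hbdd : ∀ n, f^[n] x ∈ Icc (min a x) (max b x) := by
    intro n
    cases n with
    | zero => exact ⟨min_le_right _ _, le_max_right _ _⟩
    | succ n =>
      rw [iterate_succ_apply']
      exact ⟨(min_le_left _ _).trans (hI _).1, (hI _).2.trans (le_max_left _ _)⟩
  by_cases hUio : ∃ᶠ n in Filter.atTop, f^[n] x < f^[n + 1] x
  swap
  · rw [Filter.not_frequently, Filter.eventually_atTop] at hUio
    obtain ⟨N, hN⟩ := hUio
    have hanti : Antitone (fun n => f^[n + N] x) := by
      refine antitone_nat_of_succ_le fun n => ?_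
      have := hN (n + N) (by omega)
      rw [show n + 1 + N = n + N + 1 by ring]
      exact not_lt.1 this
    have := tendsto_atTop_ciInf hanti ⟨min a x, by rintro _ ⟨n, rfl⟩; exact (hbdd _).1⟩
    exact ⟨_, (Filter.tendsto_add_atTop_iff_nat N).1 this⟩
  by_cases hDio : ∃ᶠ n in Filter.atTop, ¬ f^[n] x < f^[n + 1] x
  swap
  · rw [Filter.not_frequently, Filter.eventually_atTop] at hDio
    obtain ⟨N, hN⟩ := hDio
    have hmono : Monotone (fun n => f^[n + N] x) := by
      refine monotone_nat_of_le_succ fun n => ?_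
      have := hN (n + N) (by omega)
      rw [show n + 1 + N = n + N + 1 by ring]
      exact (not_not.1 this).le
    have := tendsto_atTop_ciSup hmono ⟨max b x, by rintro _ ⟨n, rfl⟩; exact (hbdd _).2⟩
    exact ⟨_, (Filter.tendsto_add_atTop_iff_nat N).1 this⟩
  -- both infinitely often
  obtain ⟨UV, hUV⟩ : ∃ UV : Set ℝ, UV = {y | ∃ n, f^[n] x < f^[n + 1] x ∧ f^[n] x = y} := ⟨_, rfl⟩
  obtain ⟨DV, hDV⟩ : ∃ DV : Set ℝ, DV = {y | ∃ n, ¬ f^[n] x < f^[n + 1] x ∧ f^[n] x = y} :=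
    ⟨_, rfl⟩
  have hUne : UV.Nonempty := by
    obtain ⟨n, hn⟩ := hUio.exists
    exact ⟨_, by rw [hUV]; exact ⟨n, hn, rfl⟩⟩
  have hDne : DV.Nonempty := by
    obtain ⟨n, hn⟩ := hDio.exists
    exact ⟨_, by rw [hDV]; exact ⟨n, hn, rfl⟩⟩
  have hUb : BddAbove UV := ⟨max b x, by rw [hUV]; rintro _ ⟨n, -, rfl⟩; exact (hbdd n).2⟩
  have hDb : BddBelow DV := ⟨min a x, by rw [hDV]; rintro _ ⟨n, -, rfl⟩; exact (hbdd n).1⟩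
  obtain ⟨α, hα⟩ : ∃ α, α = sSup UV := ⟨_, rfl⟩
  obtain ⟨β, hβ⟩ : ∃ β, β = sInf DV := ⟨_, rfl⟩
  have hUle : ∀ n, f^[n] x < f^[n + 1] x → f^[n] x ≤ α := fun n hn => by
    rw [hα]; exact le_csSup hUb (by rw [hUV]; exact ⟨n, hn, rfl⟩)
  have hDge : ∀ n, ¬ f^[n] x < f^[n + 1] x → β ≤ f^[n] x := fun n hn => by
    rw [hβ]; exact csInf_le hDb (by rw [hDV]; exact ⟨n, hn, rfl⟩)
  have hUnear : ∀ ε > 0, ∀ᶠ n in Filter.atTop, f^[n] x < f^[n + 1] x → |f^[n] x - α| < ε := by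
    intro ε hε
    obtain ⟨y, hy, hy2⟩ := exists_lt_of_lt_csSup hUne (show α - ε < sSup UV by rw [← hα]; linarith)
    rw [hUV] at hy
    obtain ⟨m, hm, rfl⟩ := hy
    filter_upwards [Filter.eventually_gt_atTop m] with n hn hnU
    have h1 := hU m hm n hn
    have h2 := hUle n hnU
    rw [abs_lt]; constructor <;> linarith
  have hDnear : ∀ ε > 0, ∀ᶠ n in Filter.atTop, ¬ f^[n] x < f^[n + 1] x → |f^[n] x - β| < ε := by
    intro ε hε
    obtain ⟨y, hy, hy2⟩ := exists_lt_of_csInf_lt hDne (show sInf DV < β + ε by rw [← hβ]; linarith)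
    rw [hDV] at hy
    obtain ⟨m, hm, rfl⟩ := hy
    filter_upwards [Filter.eventually_gt_atTop m] with n hn hnU
    have h1 := hD m hm n hn
    have h2 := hDge n hnU
    rw [abs_lt]; constructor <;> linarith
  -- switching
  have hswitch : ∀ (p : ℕ → Prop), (∃ᶠ n in Filter.atTop, p n) → (∃ᶠ n in Filter.atTop, ¬ p n) →
      ∃ᶠ n in Filter.atTop, p n ∧ ¬ p (n + 1) := by
    intro p h1 h2 hcon
    obtain ⟨N, hN⟩ := Filter.eventually_atTop.1 hcon
    obtain ⟨n, hn, hpn⟩ := Filter.frequently_atTop.1 h1 N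
    have : ∀ m, n ≤ m → p m := by
      intro m hm
      induction m, hm using Nat.le_induction with
      | base => exact hpn
      | succ m hm ih =>
        by_contra hc
        exact hN m (by omega) ⟨ih, hc⟩
    obtain ⟨m, hm, hpm⟩ := Filter.frequently_atTop.1 h2 n
    exact hpm (this m hm)
  have hlimit : ∀ (p : ℕ → Prop) (s t : ℝ), (∃ᶠ n in Filter.atTop, p n) →
      (∀ ε > 0, ∀ᶠ n in Filter.atTop, p n → |f^[n] x - s| < ε) →
      (∀ ε > 0, ∀ᶠ n in Filter.atTop, p n → |f^[n + 1] x - t| < ε) → f s = t := by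
    intro p s t hp hs ht
    obtain ⟨φ, hφ, hpφ⟩ := Filter.extraction_of_frequently_atTop hp
    have l1 : Filter.Tendsto (fun k => f^[φ k] x) Filter.atTop (𝓝 s) := by
      rw [Metric.tendsto_atTop']
      intro ε hε
      have := hφ.tendsto_atTop.eventually (hs ε hε)
      obtain ⟨N, hN⟩ := Filter.eventually_atTop.1 this
      exact ⟨N, fun n hn => by rw [Real.dist_eq]; exact hN n hn.le (hpφ n)⟩
    have l2 : Filter.Tendsto (fun k => f^[φ k + 1] x) Filter.atTop (𝓝 t) := by
      rw [Metric.tendsto_atTop']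
      intro ε hε
      have := hφ.tendsto_atTop.eventually (ht ε hε)
      obtain ⟨N, hN⟩ := Filter.eventually_atTop.1 this
      exact ⟨N, fun n hn => by rw [Real.dist_eq]; exact hN n hn.le (hpφ n)⟩
    have l3 : Filter.Tendsto (fun k => f^[φ k + 1] x) Filter.atTop (𝓝 (f s)) := by
      simp only [iterate_succ_apply']
      exact (hf.tendsto s).comp l1
    exact tendsto_nhds_unique l3 l2
  have hfα : f α = β := by
    refine hlimit _ α β (hswitch _ hUio hDio) (fun ε hε => ?_) (fun ε hε => ?_)
    · filter_upwards [hUnear ε hε] with n hn h using hn h.1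
    · filter_upwards [(Filter.tendsto_add_atTop_nat 1).eventually (hDnear ε hε)] with n hn h
        using hn h.2
  have hfβ : f β = α := by
    refine hlimit _ β α (hswitch _ hDio (by simpa only [not_not] using hUio))
      (fun ε hε => ?_) (fun ε hε => ?_)
    · filter_upwards [hDnear ε hε] with n hn h using hn h.1
    · filter_upwards [(Filter.tendsto_add_atTop_nat 1).eventually (hUnear ε hε)] with n hn h
        using hn (not_not.1 h.2)
  have hαβ : α = β := by
    have h2 : f^[2] α = α := by
      show f (f α) = α
      rw [hfα, hfβ]
    rw [← hfα]
    exact (hper α 2 (by norm_num) h2).symm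
  refine ⟨α, ?_⟩
  rw [Metric.tendsto_atTop']
  intro ε hε
  obtain ⟨N, hN⟩ := Filter.eventually_atTop.1 ((hUnear ε hε).and (hDnear ε hε))
  refine ⟨N, fun n hn => ?_⟩
  rw [Real.dist_eq]
  by_cases h : f^[n] x < f^[n + 1] x
  · exact (hN n hn.le).1 h
  · have := (hN n hn.le).2 h
    rwa [← hαβ] at this


/-! ### Local behaviour at periodic points -/

lemma right_side (f : ℝ → ℝ) (hf : Continuous f) (hfix : {x | f x = x}.Finite) (a b p : ℝ)
    (hp : p ∈ Icc a b) (hfp : f p = p)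
    (hside : ∀ᶠ x in 𝓝[Icc a b] p, p < x → p < f x) :
    ∃ r, p ≤ r ∧ r ≤ b ∧ (∀ x ∈ Icc p r, f x ∈ Icc p r) ∧
      (∀ ε > 0, ∃ N, ∀ n ≥ N, ∀ x ∈ Icc p r, f^[n] x < p + ε) ∧
      ∀ᶠ y in 𝓝[Icc a b] p, p ≤ y → y ∈ Icc p r ∨ y ≤ f y := by
  have htriv : (∀ x ∈ Icc p p, f x ∈ Icc p p) ∧
      (∀ ε > 0, ∃ N, ∀ n ≥ N, ∀ x ∈ Icc p p, f^[n] x < p + ε) := by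
    refine ⟨fun x hx => ?_, fun ε hε => ⟨0, fun n _ x hx => ?_⟩⟩
    · rw [Icc_self, mem_singleton_iff] at hx
      subst hx
      rw [hfp]; simp
    · rw [Icc_self, mem_singleton_iff] at hx
      subst hx
      rw [iterate_fixed hfp]; linarith
  rcases eq_or_lt_of_le hp.2 with hpb | hpb
  · refine ⟨p, le_rfl, hp.2, htriv.1, htriv.2, ?_⟩
    filter_upwards [self_mem_nhdsWithin] with y hy hpy
    left
    exact ⟨hpy, hpb ▸ hy.2⟩
  · -- no other fixed points nearby
    have h1 : ∀ᶠ x in 𝓝[≠] p, f x ≠ x := by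
      have : ({x | f x = x} \ {p})ᶜ ∈ 𝓝 p :=
        ((hfix.subset sdiff_subset).isClosed.isOpen_compl).mem_nhds (by simp)
      filter_upwards [mem_nhdsWithin_of_mem_nhds this, self_mem_nhdsWithin] with x hx hne hfx
      exact hx ⟨hfx, hne⟩
    have h1' : ∀ᶠ x in 𝓝[>] p, f x ≠ x :=
      h1.filter_mono (nhdsWithin_mono _ fun x (hx : p < x) => ne_of_gt hx)
    have h2' : ∀ᶠ x in 𝓝[>] p, p < f x := by
      have hI : Icc a b ∈ 𝓝[>] p := by
        filter_upwards [Ioc_mem_nhdsGT hpb] with x hx using ⟨hp.1.trans hx.1.le, hx.2⟩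
      have : ∀ᶠ x in 𝓝[>] p, p < x → p < f x := by
        have h3 : 𝓝[>] p ≤ 𝓝[Icc a b] p := by
          rw [nhdsWithin, nhdsWithin]
          refine le_inf inf_le_left ?_
          exact Filter.le_principal_iff.2 hI
        exact hside.filter_mono h3
      filter_upwards [this, self_mem_nhdsWithin] with x hx hx' using hx hx'
    obtain ⟨u, hu, hus⟩ := mem_nhdsGT_iff_exists_Ioc_subset.1
      (h1'.and (h2'.and (Ioc_mem_nhdsGT hpb)))
    have hu : p < u := hu
    have hne : ∀ x ∈ Ioc p u, f x ≠ x := fun x hx => (hus hx).1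
    have hgt : ∀ x ∈ Ioc p u, p < f x := fun x hx => (hus hx).2.1
    have hub : u ≤ b := (hus ⟨hu, le_rfl⟩).2.2.2
    rcases lt_or_gt_of_ne (hne u ⟨hu, le_rfl⟩) with hlt | hlt
    · have hall : ∀ x ∈ Ioc p u, f x < x := by
        intro x hx
        by_contra hcon
        push Not at hcon
        obtain ⟨z, hz, hz0⟩ := intermediate_value_Icc' hx.2
          ((hf.sub continuous_id).continuousOn) 
          (show (0 : ℝ) ∈ Icc (f u - u) (f x - x) from ⟨by linarith, by linarith⟩)
        have hz0' : f z - z = 0 := hz0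
        exact hne z ⟨lt_of_lt_of_le hx.1 hz.1, hz.2⟩ (by linarith)
      have hinv : ∀ x ∈ Icc p u, f x ∈ Icc p u := by
        intro x hx
        rcases eq_or_lt_of_le hx.1 with h | h
        · rw [← h, hfp]; exact ⟨le_rfl, hu.le⟩
        · exact ⟨(hgt x ⟨h, hx.2⟩).le, (hall x ⟨h, hx.2⟩).le.trans hx.2⟩
      refine ⟨u, hu.le, hub, hinv, ?_, ?_⟩
      · intro ε hε
        have hδ : ∃ δ > 0, ∀ x ∈ Icc (p + ε) u, δ ≤ x - f x := by
          rcases (Icc (p + ε) u).eq_empty_or_nonempty with he | he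
          · exact ⟨1, one_pos, by simp [he]⟩
          · obtain ⟨z, hz, hzm⟩ := isCompact_Icc.exists_isMinOn he
              ((continuous_id.sub hf).continuousOn)
            refine ⟨z - f z, ?_, fun x hx => hzm hx⟩
            have := hall z ⟨by linarith [hz.1], hz.2⟩
            linarith
        obtain ⟨δ, hδ0, hδ⟩ := hδ
        obtain ⟨N, hN⟩ := exists_nat_gt ((u - p) / δ)
        refine ⟨N, fun n hn x hx => ?_⟩
        have key : ∀ k, f^[k] x ∈ Icc p u ∧ (f^[k] x < p + ε ∨ f^[k] x ≤ x - k * δ) := by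
          intro k
          induction k with
          | zero => exact ⟨hx, Or.inr (by simp)⟩
          | succ k ih =>
            rw [iterate_succ_apply']
            refine ⟨hinv _ ih.1, ?_⟩
            have hle : f (f^[k] x) ≤ f^[k] x := by
              rcases eq_or_lt_of_le ih.1.1 with h | h
              · rw [← h, hfp]
              · exact (hall _ ⟨h, ih.1.2⟩).le
            by_cases hc : f^[k] x < p + ε
            · left; linarith
            · right
              have h1 := ih.2.resolve_left hc
              have h2 := hδ _ ⟨not_lt.1 hc, ih.1.2⟩
              push_cast
              linarith
        rcases (key n).2 with h | h
        · exact h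
        · exfalso
          have h1 := (key n).1.1
          have h2 : (u - p) < N * δ := by rwa [div_lt_iff₀ hδ0] at hN
          have h3 : (N : ℝ) * δ ≤ n * δ := by
            have : (N : ℝ) ≤ n := by exact_mod_cast hn
            gcongr
          linarith [hx.2]
      · filter_upwards [mem_nhdsWithin_of_mem_nhds (Iio_mem_nhds hu)] with y hy hpy
        exact Or.inl ⟨hpy, le_of_lt hy⟩
    · refine ⟨p, le_rfl, hp.2, htriv.1, htriv.2, ?_⟩
      filter_upwards [mem_nhdsWithin_of_mem_nhds (Iio_mem_nhds hu)] with y hy hpy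
      right
      rcases eq_or_lt_of_le hpy with h | h
      · rw [← h, hfp]
      by_contra hcon
      push Not at hcon
      have hy : y < u := hy
      obtain ⟨z, hz, hz0⟩ := intermediate_value_Icc hy.le
          ((hf.sub continuous_id).continuousOn) 
          (show (0 : ℝ) ∈ Icc (f y - y) (f u - u) from ⟨by linarith, by linarith⟩)
      have hz0' : f z - z = 0 := hz0
      exact hne z ⟨lt_of_lt_of_le h hz.1, hz.2⟩ (by linarith)

lemma left_side (f : ℝ → ℝ) (hf : Continuous f) (hfix : {x | f x = x}.Finite) (a b p : ℝ)
    (hp : p ∈ Icc a b) (hfp : f p = p)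
    (hside : ∀ᶠ x in 𝓝[Icc a b] p, x < p → f x < p) :
    ∃ l, l ≤ p ∧ a ≤ l ∧ (∀ x ∈ Icc l p, f x ∈ Icc l p) ∧
      (∀ ε > 0, ∃ N, ∀ n ≥ N, ∀ x ∈ Icc l p, p - ε < f^[n] x) ∧
      ∀ᶠ y in 𝓝[Icc a b] p, y ≤ p → y ∈ Icc l p ∨ f y ≤ y := by
  have htend : ∀ (a b p : ℝ), Filter.Tendsto (fun x : ℝ => -x)
      (𝓝[Icc (-b) (-a)] (-p)) (𝓝[Icc a b] p) := by
    intro a b p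
    refine tendsto_nhdsWithin_iff.2 ⟨?_, ?_⟩
    · have : Filter.Tendsto (fun x : ℝ => -x) (𝓝 (-p)) (𝓝 p) := by
        simpa using (continuous_neg (G := ℝ)).tendsto (-p)
      exact this.mono_left nhdsWithin_le_nhds
    · filter_upwards [self_mem_nhdsWithin] with x hx
      exact ⟨by linarith [hx.2], by linarith [hx.1]⟩
  have hfix' : {x | (fun t => -f (-t)) x = x}.Finite := by
    refine (hfix.image (fun x => -x)).subset ?_
    intro x hx
    rw [mem_ofPred_eq] at hx
    refine ⟨-x, ?_, by simp⟩
    rw [mem_ofPred_eq]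
    linarith
  obtain ⟨r, h1, h2, h3, h4, h5⟩ := right_side (fun t => -f (-t)) (by fun_prop) hfix'
    (-b) (-a) (-p) ⟨by linarith [hp.2], by linarith [hp.1]⟩ (by simp [hfp])
    (by
      filter_upwards [(htend a b p).eventually hside] with x hx hpx
      have := hx (by linarith)
      linarith)
  refine ⟨-r, by linarith, by linarith, ?_, ?_, ?_⟩
  · intro x hx
    have := h3 (-x) ⟨by linarith [hx.2], by linarith [hx.1]⟩
    simp only [neg_neg] at this
    exact ⟨by linarith [this.2], by linarith [this.1]⟩
  · intro ε hε
    obtain ⟨N, hN⟩ := h4 ε hε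
    refine ⟨N, fun n hn x hx => ?_⟩
    have := hN n hn (-x) ⟨by linarith [hx.2], by linarith [hx.1]⟩
    rw [neg_conj_iterate, neg_neg] at this
    linarith
  · have h6 := htend (-b) (-a) (-p)
    rw [neg_neg, neg_neg, neg_neg] at h6
    filter_upwards [h6.eventually h5] with y hy hyp
    rcases hy (by linarith) with h | h
    · exact Or.inl ⟨by linarith [h.2], by linarith [h.1]⟩
    · right
      simp only [neg_neg] at h
      linarith

lemma local_noncrit (f : ℝ → ℝ) (hf : Continuous f) (hfix : {x | f x = x}.Finite) (a b p : ℝ)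
    (hp : p ∈ Icc a b) (hfp : f p = p)
    (hside : ∀ᶠ x in 𝓝[Icc a b] p, (p < x → p < f x) ∧ (x < p → f x < p)) :
    ∃ l r, a ≤ l ∧ l ≤ p ∧ p ≤ r ∧ r ≤ b ∧ (∀ x ∈ Icc l r, f x ∈ Icc l r) ∧
      (∀ ε > 0, ∃ N, ∀ n ≥ N, ∀ x ∈ Icc l r, |f^[n] x - p| < ε) ∧
      ∀ᶠ y in 𝓝[Icc a b] p, y ∈ Icc l r ∨ |y - p| ≤ |f y - p| := by
  obtain ⟨r, h1, h2, h3, h4, h5⟩ := right_side f hf hfix a b p hp hfp (hside.mono fun x h => h.1)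
  obtain ⟨l, g1, g2, g3, g4, g5⟩ := left_side f hf hfix a b p hp hfp (hside.mono fun x h => h.2)
  refine ⟨l, r, g2, g1, h1, h2, ?_, ?_, ?_⟩
  · intro x hx
    rcases le_total x p with h | h
    · have := g3 x ⟨hx.1, h⟩
      exact ⟨this.1, this.2.trans h1⟩
    · have := h3 x ⟨h, hx.2⟩
      exact ⟨g1.trans this.1, this.2⟩
  · intro ε hε
    obtain ⟨N, hN⟩ := h4 ε hε
    obtain ⟨N', hN'⟩ := g4 ε hε
    refine ⟨max N N', fun n hn x hx => ?_⟩
    have hR : ∀ x ∈ Icc p r, ∀ n, f^[n] x ∈ Icc p r := fun x hx n =>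
      MapsTo.iterate (s := Icc p r) (fun x hx => h3 x hx) n hx
    have hL : ∀ x ∈ Icc l p, ∀ n, f^[n] x ∈ Icc l p := fun x hx n =>
      MapsTo.iterate (s := Icc l p) (fun x hx => g3 x hx) n hx
    rw [abs_lt]
    rcases le_total x p with h | h
    · have := hN' n (le_of_max_le_right hn) x ⟨hx.1, h⟩
      have := (hL x ⟨hx.1, h⟩ n).2
      constructor <;> linarith
    · have := hN n (le_of_max_le_left hn) x ⟨h, hx.2⟩
      have := (hR x ⟨h, hx.2⟩ n).1
      constructor <;> linarith
  · filter_upwards [h5, g5] with y hy hy'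
    rcases le_total y p with h | h
    · rcases hy' h with k | k
      · exact Or.inl ⟨k.1, k.2.trans h1⟩
      · right
        rw [abs_of_nonpos (by linarith), abs_of_nonpos (by linarith)]
        linarith
    · rcases hy h with k | k
      · exact Or.inl ⟨g1.trans k.1, k.2⟩
      · right
        rw [abs_of_nonneg (by linarith), abs_of_nonneg (by linarith)]
        linarith

lemma local_crit (f : ℝ → ℝ) (a b p : ℝ) (hp : p ∈ Ioo a b) (hfp : f p = p)
    (hd : HasDerivAt f 0 p) :
    ∃ l r, a ≤ l ∧ l ≤ p ∧ p ≤ r ∧ r ≤ b ∧ (∀ x ∈ Icc l r, f x ∈ Icc l r) ∧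
      (∀ ε > 0, ∃ N, ∀ n ≥ N, ∀ x ∈ Icc l r, |f^[n] x - p| < ε) ∧
      ∀ᶠ y in 𝓝[Icc a b] p, y ∈ Icc l r ∨ |y - p| ≤ |f y - p| := by
  have h1 : ∀ᶠ x in 𝓝 p, |f x - p| ≤ 1 / 2 * |x - p| := by
    have := (hasDerivAt_iff_isLittleO.1 hd).def (show (0 : ℝ) < 1 / 2 by norm_num)
    filter_upwards [this] with x hx
    simpa [hfp] using hx
  obtain ⟨e, he, hball⟩ := Metric.eventually_nhds_iff_ball.1
    (h1.and (Ioo_mem_nhds hp.1 hp.2))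
  have hmem : ∀ x, |x - p| ≤ e / 2 ↔ x ∈ Icc (p - e / 2) (p + e / 2) := by
    intro x
    rw [abs_le]
    constructor
    · rintro ⟨h, h'⟩; exact ⟨by linarith, by linarith⟩
    · rintro ⟨h, h'⟩; exact ⟨by linarith, by linarith⟩
  have hcon : ∀ x, |x - p| ≤ e / 2 → |f x - p| ≤ 1 / 2 * |x - p| ∧ x ∈ Ioo a b := by
    intro x hx
    exact hball x (by rw [Metric.mem_ball, Real.dist_eq]; linarith)
  have hL := (hcon (p - e / 2) (by rw [hmem]; constructor <;> linarith)).2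
  have hR := (hcon (p + e / 2) (by rw [hmem]; constructor <;> linarith)).2
  refine ⟨p - e / 2, p + e / 2, hL.1.le, by linarith, by linarith, hR.2.le, ?_, ?_, ?_⟩
  · intro x hx
    rw [← hmem] at hx ⊢
    have := (hcon x hx).1
    have := abs_nonneg (x - p)
    linarith
  · intro ε hε
    obtain ⟨N, hN⟩ := exists_pow_lt_of_lt_one (show 0 < ε / e by positivity)
      (show (1 / 2 : ℝ) < 1 by norm_num)
    refine ⟨N, fun n hn x hx => ?_⟩
    rw [← hmem] at hx
    have key : ∀ k, |f^[k] x - p| ≤ (1 / 2) ^ k * (e / 2) ∧ |f^[k] x - p| ≤ e / 2 := by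
      intro k
      induction k with
      | zero => simpa using hx
      | succ k ih =>
        rw [iterate_succ_apply', pow_succ]
        have := (hcon _ ih.2).1
        have := abs_nonneg (f^[k] x - p)
        constructor <;> linarith [ih.1, ih.2]
    have h2 : (1 / 2 : ℝ) ^ n ≤ (1 / 2) ^ N :=
      pow_le_pow_of_le_one (by norm_num) (by norm_num) hn
    have h3 : (1 / 2 : ℝ) ^ N * e < ε := by rwa [lt_div_iff₀ he] at hN
    have h4 := (key n).1
    have h5 : (1 / 2 : ℝ) ^ n * e ≤ (1 / 2) ^ N * e := by gcongr
    have h6 : 0 < (1 / 2 : ℝ) ^ n * e := by positivity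
    linarith
  · have : ∀ᶠ y in 𝓝 p, y ∈ Icc (p - e / 2) (p + e / 2) :=
      Icc_mem_nhds (by linarith) (by linarith)
    filter_upwards [mem_nhdsWithin_of_mem_nhds this] with y hy using Or.inl hy

lemma sign_pres (G : ℝ → ℝ) (hGc : Continuous G) (hGI : ∀ x, G x ∈ Icc (-1 : ℝ) 1)
    (hmono : StrictMonoOn G (Icc (-1) 0)) (hanti : StrictAntiOn G (Icc 0 1))
    (p : ℝ) (hp : p ∈ Icc (-1 : ℝ) 1) (n : ℕ) (h0 : ∀ i < n, G^[i] p ≠ 0) :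
    (∀ᶠ x in 𝓝[Icc (-1) 1] p, (p < x → G^[n] p < G^[n] x) ∧ (x < p → G^[n] x < G^[n] p)) ∨
    (∀ᶠ x in 𝓝[Icc (-1) 1] p, (p < x → G^[n] x < G^[n] p) ∧ (x < p → G^[n] p < G^[n] x)) := by
  have hit : ∀ n, ∀ x ∈ Icc (-1 : ℝ) 1, G^[n] x ∈ Icc (-1 : ℝ) 1 := fun n x hx =>
    MapsTo.iterate (s := Icc (-1 : ℝ) 1) (fun x _ => hGI x) n hx
  induction n with
  | zero => left; exact Filter.Eventually.of_forall fun x => ⟨fun h => h, fun h => h⟩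
  | succ n ih =>
    have ih := ih fun i hi => h0 i (by omega)
    have hq := h0 n (by omega)
    have hqI := hit n p hp
    have htend : Filter.Tendsto (G^[n]) (𝓝[Icc (-1) 1] p) (𝓝[Icc (-1) 1] (G^[n] p)) := by
      refine tendsto_nhdsWithin_iff.2 ⟨((hGc.iterate n).tendsto p).mono_left nhdsWithin_le_nhds, ?_⟩
      filter_upwards [self_mem_nhdsWithin] with x hx using hit n x hx
    rcases lt_or_gt_of_ne hq with hq | hq
    · have hev : ∀ᶠ x in 𝓝[Icc (-1) 1] p, G^[n] x ∈ Icc (-1 : ℝ) 0 := by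
        refine htend.eventually ?_
        filter_upwards [self_mem_nhdsWithin, mem_nhdsWithin_of_mem_nhds (Iio_mem_nhds hq)]
          with y hy hy' using ⟨hy.1, le_of_lt hy'⟩
      have hpm : G^[n] p ∈ Icc (-1 : ℝ) 0 := ⟨hqI.1, hq.le⟩
      rcases ih with ih | ih
      · left
        filter_upwards [ih, hev] with x hx hxm
        rw [iterate_succ_apply', iterate_succ_apply']
        exact ⟨fun h => hmono hpm hxm (hx.1 h), fun h => hmono hxm hpm (hx.2 h)⟩
      · right
        filter_upwards [ih, hev] with x hx hxm
        rw [iterate_succ_apply', iterate_succ_apply']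
        exact ⟨fun h => hmono hxm hpm (hx.1 h), fun h => hmono hpm hxm (hx.2 h)⟩
    · have hev : ∀ᶠ x in 𝓝[Icc (-1) 1] p, G^[n] x ∈ Icc (0 : ℝ) 1 := by
        refine htend.eventually ?_
        filter_upwards [self_mem_nhdsWithin, mem_nhdsWithin_of_mem_nhds (Ioi_mem_nhds hq)]
          with y hy hy' using ⟨le_of_lt hy', hy.2⟩
      have hpm : G^[n] p ∈ Icc (0 : ℝ) 1 := ⟨hq.le, hqI.2⟩
      rcases ih with ih | ih
      · right
        filter_upwards [ih, hev] with x hx hxm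
        rw [iterate_succ_apply', iterate_succ_apply']
        exact ⟨fun h => hanti hpm hxm (hx.1 h), fun h => hanti hxm hpm (hx.2 h)⟩
      · left
        filter_upwards [ih, hev] with x hx hxm
        rw [iterate_succ_apply', iterate_succ_apply']
        exact ⟨fun h => hanti hxm hpm (hx.1 h), fun h => hanti hpm hxm (hx.2 h)⟩

lemma sign_pres_even (G : ℝ → ℝ) (hGc : Continuous G) (hGI : ∀ x, G x ∈ Icc (-1 : ℝ) 1)
    (hmono : StrictMonoOn G (Icc (-1) 0)) (hanti : StrictAntiOn G (Icc 0 1))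
    (p : ℝ) (hp : p ∈ Icc (-1 : ℝ) 1) (n : ℕ) (h0 : ∀ i < n, G^[i] p ≠ 0) (hn : G^[n] p = p) :
    ∀ᶠ x in 𝓝[Icc (-1) 1] p, (p < x → p < G^[n + n] x) ∧ (x < p → G^[n + n] x < p) := by
  have htend : Filter.Tendsto (G^[n]) (𝓝[Icc (-1) 1] p) (𝓝[Icc (-1) 1] p) := by
    refine tendsto_nhdsWithin_iff.2 ⟨?_, ?_⟩
    · have := (hGc.iterate n).tendsto p
      rw [hn] at this
      exact this.mono_left nhdsWithin_le_nhds
    · filter_upwards [self_mem_nhdsWithin] with x hx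
      exact MapsTo.iterate (s := Icc (-1 : ℝ) 1) (fun x _ => hGI x) n hx
  have key := sign_pres G hGc hGI hmono hanti p hp n h0
  rw [hn] at key
  rcases key with h | h
  · filter_upwards [h, htend.eventually h] with x h1 h2
    rw [iterate_add_apply]
    exact ⟨fun hh => h2.1 (h1.1 hh), fun hh => h2.2 (h1.2 hh)⟩
  · filter_upwards [h, htend.eventually h] with x h1 h2
    rw [iterate_add_apply]
    exact ⟨fun hh => h2.2 (h1.1 hh), fun hh => h2.1 (h1.2 hh)⟩

lemma deriv_iter (G : ℝ → ℝ) (hd : ∀ x ∈ Ioo (-1 : ℝ) 1, DifferentiableAt ℝ G x)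
    (hd0 : HasDerivAt G 0 0) (p : ℝ) (n : ℕ) (hin : ∀ i < n, G^[i] p ∈ Ioo (-1 : ℝ) 1) :
    ∃ d, HasDerivAt (G^[n]) d p ∧ ((∃ i < n, G^[i] p = 0) → d = 0) := by
  induction n with
  | zero => exact ⟨1, hasDerivAt_id p, by rintro ⟨i, hi, -⟩; omega⟩
  | succ n ih =>
    obtain ⟨d, h1, h2⟩ := ih fun i hi => hin i (by omega)
    by_cases hc : G^[n] p = 0
    · refine ⟨0 * d, ?_, fun _ => by simp⟩
      rw [iterate_succ']
      refine HasDerivAt.comp p ?_ h1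
      rw [hc]; exact hd0
    · refine ⟨deriv G (G^[n] p) * d, ?_, ?_⟩
      · rw [iterate_succ']
        exact HasDerivAt.comp p (hd _ (hin n (by omega))).hasDerivAt h1
      · rintro ⟨i, hi, h0⟩
        have : i ≠ n := by rintro rfl; exact hc h0
        rw [h2 ⟨i, by omega, h0⟩, mul_zero]

/-- The local picture at a periodic point. -/
lemma local_all (G : ℝ → ℝ) (hGc : Continuous G) (hGI : ∀ x, G x ∈ Icc (-1 : ℝ) 1)
    (hmono : StrictMonoOn G (Icc (-1) 0)) (hanti : StrictAntiOn G (Icc 0 1))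
    (hm1 : G (-1) = -1) (h1 : G 1 = -1)
    (hd : ∀ x ∈ Ioo (-1 : ℝ) 1, DifferentiableAt ℝ G x) (hd0 : HasDerivAt G 0 0)
    (n : ℕ) (hn : 0 < n) (hfix : {x | G^[n + n] x = x}.Finite) (p : ℝ) (hp : p ∈ Icc (-1 : ℝ) 1)
    (hnp : G^[n] p = p) :
    ∃ l r, -1 ≤ l ∧ l ≤ p ∧ p ≤ r ∧ r ≤ 1 ∧ (∀ x ∈ Icc l r, G^[n + n] x ∈ Icc l r) ∧
      (∀ ε > 0, ∃ N, ∀ m ≥ N, ∀ x ∈ Icc l r, |(G^[n + n])^[m] x - p| < ε) ∧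
      ∀ᶠ y in 𝓝[Icc (-1) 1] p, y ∈ Icc l r ∨ |y - p| ≤ |G^[n + n] y - p| := by
  have hfp : G^[n + n] p = p := by rw [iterate_add_apply, hnp, hnp]
  by_cases h0 : ∀ i < n, G^[i] p ≠ 0
  · exact local_noncrit _ (hGc.iterate _) hfix _ _ _ hp hfp
      (sign_pres_even G hGc hGI hmono hanti p hp n h0 hnp)
  · push Not at h0
    obtain ⟨j, hj, hj0⟩ := h0
    have hfixm1 : ∀ k, G^[k] (-1) = -1 := fun k => iterate_fixed hm1 k
    -- no point of the orbit is an endpoint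
    have hnm1 : ∀ i, G^[i] p ≠ -1 := by
      intro i hi
      have h2 : ∀ k, i ≤ k → G^[k] p = -1 := by
        intro k hk
        obtain ⟨c, rfl⟩ := Nat.exists_eq_add_of_le' hk
        rw [iterate_add_apply, hi, hfixm1]
      have h3 : G^[j + n * i] p = 0 := by
        rw [iterate_add_apply, iterate_mul, iterate_fixed hnp, hj0]
      rw [h2 _ (by nlinarith)] at h3
      norm_num at h3
    have hin : ∀ i < n + n, G^[i] p ∈ Ioo (-1 : ℝ) 1 := by
      intro i _
      have hI : G^[i] p ∈ Icc (-1 : ℝ) 1 :=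
        MapsTo.iterate (s := Icc (-1 : ℝ) 1) (fun x _ => hGI x) i hp
      refine ⟨lt_of_le_of_ne hI.1 (hnm1 i).symm, lt_of_le_of_ne hI.2 ?_⟩
      intro h
      apply hnm1 (i + 1)
      rw [iterate_succ_apply', h, h1]
    obtain ⟨d, hd1, hd2⟩ := deriv_iter G hd hd0 p (n + n) hin
    rw [hd2 ⟨j, by omega, hj0⟩] at hd1
    exact local_crit _ _ _ _ (hin 0 (by omega)) hfp hd1

/-! ### Assembly -/

lemma assemble (G : ℝ → ℝ) (hGc : Continuous G) (hGI : ∀ x, G x ∈ Icc (-1 : ℝ) 1)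
    (hmono : StrictMonoOn G (Icc (-1) 0)) (hanti : StrictAntiOn G (Icc 0 1))
    (hm1 : G (-1) = -1) (h1 : G 1 = -1)
    (hd : ∀ x ∈ Ioo (-1 : ℝ) 1, DifferentiableAt ℝ G x) (hd0 : HasDerivAt G 0 0)
    (hfin : {x | ∃ n, 0 < n ∧ G^[n] x = x}.Finite)
    (gY : Icc (-1 : ℝ) 1 → Icc (-1 : ℝ) 1) (hgY : ∀ y, (gY y : ℝ) = G y) :
    IsFactorOfFiniteAutomaton gY := by
  classical
  let P : Type := {x : ℝ // ∃ n, 0 < n ∧ G^[n] x = x}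
  haveI : Finite P := hfin
  haveI : Nonempty P := ⟨⟨-1, 1, one_pos, hm1⟩⟩
  haveI : Fintype P := Fintype.ofFinite P
  have hPI : ∀ p : P, p.1 ∈ Icc (-1 : ℝ) 1 := by
    rintro ⟨p, n, hn, hp⟩
    obtain ⟨m, rfl⟩ : ∃ m, n = m + 1 := ⟨n - 1, by omega⟩
    rw [iterate_succ_apply'] at hp
    show p ∈ _
    rw [← hp]; exact hGI _
  -- common period
  obtain ⟨n, hn, hnp⟩ : ∃ n, 0 < n ∧ ∀ p : P, G^[n] p.1 = p.1 := by
    choose per hper0 hper using fun p : P => p.2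
    refine ⟨∏ p, per p, Finset.prod_pos fun p _ => hper0 p, fun p => ?_⟩
    obtain ⟨k, hk⟩ := Finset.dvd_prod_of_mem per (Finset.mem_univ p)
    rw [hk, iterate_mul, iterate_fixed (hper p)]
  obtain ⟨M, hM⟩ : ∃ M, M = n + n := ⟨_, rfl⟩
  have hM0 : 0 < M := by omega
  have hMp : ∀ p : P, G^[M] p.1 = p.1 := by
    intro p; rw [hM, iterate_add_apply, hnp, hnp]
  have hfix : {x | G^[M] x = x}.Finite := hfin.subset fun x hx => ⟨M, hM0, hx⟩
  have hper : ∀ x k, 0 < k → (G^[M])^[k] x = x → G^[M] x = x := by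
    intro x k hk hx
    rw [← iterate_mul] at hx
    exact hMp ⟨x, M * k, by positivity, hx⟩
  have hfI : ∀ x, G^[M] x ∈ Icc (-1 : ℝ) 1 := by
    intro x
    obtain ⟨m, hm⟩ : ∃ m, M = m + 1 := ⟨M - 1, by omega⟩
    rw [hm, iterate_succ_apply']
    exact hGI _
  have hitI : ∀ k, ∀ x ∈ Icc (-1 : ℝ) 1, G^[k] x ∈ Icc (-1 : ℝ) 1 := fun k x hx =>
    MapsTo.iterate (s := Icc (-1 : ℝ) 1) (fun x _ => hGI x) k hx
  -- local pieces
  have hloc : ∀ p : P, ∃ l r, -1 ≤ l ∧ l ≤ p.1 ∧ p.1 ≤ r ∧ r ≤ 1 ∧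
      (∀ x ∈ Icc l r, G^[M] x ∈ Icc l r) ∧
      (∀ ε > 0, ∃ N, ∀ m ≥ N, ∀ x ∈ Icc l r, |(G^[M])^[m] x - p.1| < ε) ∧
      ∀ᶠ y in 𝓝[Icc (-1) 1] p.1, y ∈ Icc l r ∨ |y - p.1| ≤ |G^[M] y - p.1| := by
    intro p
    rw [hM] at hfix ⊢
    exact local_all G hGc hGI hmono hanti hm1 h1 hd hd0 n hn hfix p.1 (hPI p) (hnp p)
  choose a b ha hap hpb hb hinv hconv hev using hloc
  -- the bijection on periodic points
  let t : P → P := fun p => ⟨G p.1, p.2.choose, p.2.choose_spec.1, by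
    rw [← iterate_succ_apply, iterate_succ_apply', p.2.choose_spec.2]⟩
  have ht : ∀ p, (t p).1 = G p.1 := fun p => rfl
  have htinj : Injective t := by
    intro p q hpq
    have h2 : G p.1 = G q.1 := congrArg Subtype.val hpq
    obtain ⟨m, hm⟩ : ∃ m, M = m + 1 := ⟨M - 1, by omega⟩
    apply Subtype.ext
    rw [← hMp p, ← hMp q, hm, iterate_succ_apply, iterate_succ_apply, h2]
  let τ : P ≃ P := Equiv.ofBijective t (Finite.injective_iff_bijective.1 htinj)
  have hτ : ∀ p, (τ p).1 = G p.1 := fun p => rfl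
  -- the big cells
  let J : P → Type := fun p => {x : P × Fin M // G^[(x.2 : ℕ)] x.1.1 = p.1}
  let piece : (p : P) → J p → Set ℝ := fun p x => G^[(x.1.2 : ℕ)] '' Icc (a x.1.1) (b x.1.1)
  let K : P → Set ℝ := fun p => ⋃ x : J p, piece p x
  have hmemK : ∀ p y, y ∈ K p ↔ ∃ (q : P) (i : ℕ), i < M ∧ G^[i] q.1 = p.1 ∧
      ∃ z ∈ Icc (a q) (b q), G^[i] z = y := by
    intro p y
    constructor
    · intro hy
      obtain ⟨x, hx⟩ := mem_iUnion.1 hy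
      obtain ⟨z, hz, hzy⟩ := hx
      exact ⟨x.1.1, x.1.2, x.1.2.2, x.2, z, hz, hzy⟩
    · rintro ⟨q, i, hi, hq, z, hz, hzy⟩
      exact mem_iUnion.2 ⟨⟨(q, ⟨i, hi⟩), hq⟩, z, hz, hzy⟩
  have hLK : ∀ p, Icc (a p) (b p) ⊆ K p := by
    intro p y hy
    exact (hmemK p y).2 ⟨p, 0, hM0, rfl, y, hy, rfl⟩
  have hpK : ∀ p : P, p.1 ∈ K p := fun p => hLK p ⟨hap p, hpb p⟩
  have hKI : ∀ p, K p ⊆ Icc (-1) 1 := by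
    intro p y hy
    obtain ⟨q, i, hi, hq, z, hz, rfl⟩ := (hmemK p y).1 hy
    exact hitI i z ⟨(ha q).trans hz.1, hz.2.trans (hb q)⟩
  have hKcomp : ∀ p, IsCompact (K p) := by
    intro p
    haveI : Finite (J p) := Subtype.finite
    exact isCompact_iUnion fun x => isCompact_Icc.image (hGc.iterate _)
  have hKconn : ∀ p, IsConnected (K p) := by
    intro p
    refine ⟨⟨_, hpK p⟩, ?_⟩
    refine isPreconnected_iUnion ⟨p.1, mem_iInter.2 fun x => ?_⟩ fun x => ?_
    · exact ⟨x.1.1.1, ⟨hap _, hpb _⟩, x.2⟩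
    · exact isPreconnected_Icc.image _ (hGc.iterate _).continuousOn
  have hKIcc : ∀ p, K p = Icc (sInf (K p)) (sSup (K p)) := fun p =>
    eq_Icc_of_connected_compact (hKconn p) (hKcomp p)
  have hKinv : ∀ p, ∀ y ∈ K p, G y ∈ K (τ p) := by
    intro p y hy
    obtain ⟨q, i, hi, hq, z, hz, rfl⟩ := (hmemK p y).1 hy
    rw [hmemK]
    by_cases hiM : i + 1 < M
    · refine ⟨q, i + 1, hiM, ?_, z, hz, ?_⟩
      · rw [iterate_succ_apply', hq, hτ]
      · rw [iterate_succ_apply']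
    · have hiM' : M = i + 1 := by omega
      refine ⟨q, 0, hM0, ?_, G^[M] z, hinv q z hz, ?_⟩
      · have h2 := hMp q
        rw [hiM', iterate_succ_apply', hq] at h2
        rw [hτ, h2]; rfl
      · rw [hiM', iterate_succ_apply']; rfl
  have hunifK : ∀ ε > 0, ∃ N, ∀ m ≥ N, ∀ p, ∀ y ∈ K p,
      dist (G^[m] y) (G^[m] p.1) < ε := by
    intro ε hε
    have hq : ∀ (q : P) (j : Fin M), ∀ᶠ k in Filter.atTop, ∀ z ∈ Icc (a q) (b q),
        dist (G^[(j : ℕ)] ((G^[M])^[k] z)) (G^[(j : ℕ)] q.1) < ε := by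
      intro q j
      obtain ⟨δ, hδ, hδ'⟩ := Metric.continuousAt_iff.1 ((hGc.iterate j).continuousAt (x := q.1)) ε hε
      obtain ⟨N, hN⟩ := hconv q δ hδ
      filter_upwards [Filter.eventually_ge_atTop N] with k hk z hz
      exact hδ' (by rw [Real.dist_eq]; exact hN k hk z hz)
    obtain ⟨N, hN⟩ := Filter.eventually_atTop.1
      (Filter.eventually_all.2 fun q => Filter.eventually_all.2 fun j => hq q j)
    refine ⟨M * N, fun m hm p y hy => ?_⟩
    obtain ⟨q, i, hi, hqp, z, hz, rfl⟩ := (hmemK p y).1 hy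
    have hk : N ≤ (m + i) / M := by
      rw [Nat.le_div_iff_mul_le hM0]
      nlinarith
    have := hN _ hk q ⟨(m + i) % M, Nat.mod_lt _ hM0⟩ z hz
    simp only at this
    rw [← hqp, ← iterate_add_apply, ← iterate_add_apply]
    have hdecomp : ∀ w, G^[m + i] w = G^[(m + i) % M] ((G^[M])^[(m + i) / M] w) := by
      intro w
      rw [← iterate_mul, ← iterate_add_apply, Nat.mod_add_div]
    rw [hdecomp z, hdecomp q.1, iterate_fixed (hMp q)]
    exact this
  have henter : ∀ x ∈ Icc (-1 : ℝ) 1, ∃ k p, G^[k] x ∈ K p := by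
    intro x hx
    obtain ⟨p, hp, hlim⟩ := orbit_converges (G^[M]) (hGc.iterate M) (-1) 1 hfI hfix hper x
    let q : P := ⟨p, M, hM0, hp⟩
    by_contra hcon
    push Not at hcon
    have hnL : ∀ k, (G^[M])^[k] x ∉ Icc (a q) (b q) := by
      intro k hk
      rw [← iterate_mul] at hk
      exact hcon _ q (hLK q hk)
    have hlim' : Filter.Tendsto (fun k => (G^[M])^[k] x) Filter.atTop (𝓝[Icc (-1) 1] p) := by
      refine tendsto_nhdsWithin_iff.2 ⟨hlim, Filter.Eventually.of_forall fun k => ?_⟩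
      rw [← iterate_mul]
      exact hitI _ x hx
    obtain ⟨N, hN⟩ := Filter.eventually_atTop.1 (hlim'.eventually (hev q))
    have hstep : ∀ k ≥ N, |(G^[M])^[k] x - p| ≤ |(G^[M])^[k + 1] x - p| := by
      intro k hk
      rw [iterate_succ_apply']
      exact (hN k hk).resolve_left (hnL k)
    have hlow : ∀ k ≥ N, |(G^[M])^[N] x - p| ≤ |(G^[M])^[k] x - p| := by
      intro k hk
      induction k, hk using Nat.le_induction with
      | base => exact le_rfl
      | succ k hk ih => exact ih.trans (hstep k hk)
    have hpos : 0 < |(G^[M])^[N] x - p| := by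
      rw [abs_pos, sub_ne_zero]
      intro h
      apply hnL N
      rw [h]
      exact ⟨hap q, hpb q⟩
    obtain ⟨N', hN'⟩ := Filter.eventually_atTop.1 (Metric.tendsto_nhds.1 hlim _ hpos)
    have e1 := hN' (max N N') (le_max_right _ _)
    rw [Real.dist_eq] at e1
    exact absurd (hlow (max N N') (le_max_left _ _)) (not_le.2 e1)
  refine interval_factor G hGc hGI hmono hanti hm1 h1 τ (fun p => sInf (K p))
    (fun p => sSup (K p)) ?_ ?_ (fun p => p.1) ?_ ?_ ?_ ?_ ?_ gY hgY
  · intro p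
    exact (hKI p ((hKcomp p).sInf_mem ⟨_, hpK p⟩)).1
  · intro p
    exact (hKI p ((hKcomp p).sSup_mem ⟨_, hpK p⟩)).2
  · intro p
    rw [← hKIcc]; exact hpK p
  · intro p; exact (hτ p).symm
  · intro p y hy
    rw [← hKIcc] at hy ⊢
    exact hKinv p y hy
  · intro ε hε
    obtain ⟨N, hN⟩ := hunifK ε hε
    refine ⟨N, fun m hm p y hy => hN m hm p y ?_⟩
    rw [hKIcc]; exact hy
  · intro x hx
    obtain ⟨k, p, hk⟩ := henter x hx
    refine ⟨k, p, ?_⟩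
    rw [← hKIcc]; exact hk

lemma unimodal_strictMono (g : ℝ → ℝ) (hg : SymmetricUnimodal g)
    (hmaps : MapsTo g (Icc (-1) 1) (Icc (-1) 1)) : StrictMonoOn g (Icc (-1) 0) := by
  obtain ⟨hC, hsym, hm1, h1, h0, hd⟩ := hg
  have hcont : ContinuousOn g (Icc (-1) 0) :=
    hC.continuousOn.mono (Icc_subset_Icc_right zero_le_one)
  have hcrit : ∀ c ∈ Ioo (-1 : ℝ) 0, deriv g c ≠ 0 := by
    intro c hc h
    have hn : Icc (-1 : ℝ) 1 ∈ 𝓝 c := Icc_mem_nhds hc.1 (by linarith [hc.2])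
    rw [← derivWithin_of_mem_nhds hn] at h
    have := (hd c ⟨hc.1.le, by linarith [hc.2]⟩).1 h
    linarith [hc.2]
  have hne : ∀ x ∈ Icc (-1 : ℝ) 0, ∀ y ∈ Icc (-1 : ℝ) 0, x < y → g x ≠ g y := by
    intro x hx y hy hxy h
    obtain ⟨c, hc, hc0⟩ := exists_deriv_eq_zero hxy
      (hcont.mono (Icc_subset_Icc hx.1 hy.2)) h
    exact hcrit c ⟨hx.1.trans_lt hc.1, hc.2.trans_le hy.2⟩ hc0
  refine ContinuousOn.strictMonoOn_of_injOn_Icc (by norm_num) (by rw [hm1]; exact h0.le) hcont ?_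
  intro x hx y hy h
  rcases lt_trichotomy x y with hl | hl | hl
  · exact absurd h (hne x hx y hy hl)
  · exact hl
  · exact absurd h.symm (hne y hy x hx hl)
/-- A symmetric unimodal system with a finite number of periodic points is a factor
of a finite automaton. -/
theorem unimodal_finitePeriodic_isFactorOfFiniteAutomaton (g : ℝ → ℝ)
    (hg : SymmetricUnimodal g)
    (hmaps : Set.MapsTo g (Set.Icc (-1) 1) (Set.Icc (-1) 1))
    (hfin : {x : ℝ | x ∈ Set.Icc (-1:ℝ) 1 ∧ ∃ n : ℕ, 0 < n ∧ g^[n] x = x}.Finite) :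
    IsFactorOfFiniteAutomaton (Set.MapsTo.restrict g _ _ hmaps) := by
  have hmono := unimodal_strictMono g hg hmaps
  obtain ⟨hC, hsym, hm1, h1, h0, hd⟩ := hg
  obtain ⟨c, hc⟩ : ∃ c : ℝ → ℝ, c = fun x => max (-1) (min 1 x) := ⟨_, rfl⟩
  have hcc : Continuous c := by rw [hc]; fun_prop
  have hcI : ∀ x, c x ∈ Icc (-1 : ℝ) 1 := by
    intro x
    rw [hc]
    exact ⟨le_max_left _ _, max_le (by norm_num) (min_le_left _ _)⟩
  have hcid : ∀ x ∈ Icc (-1 : ℝ) 1, c x = x := by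
    intro x hx
    rw [hc]
    simp only
    rw [min_eq_right hx.2, max_eq_right hx.1]
  have hGg : ∀ x ∈ Icc (-1 : ℝ) 1, (g ∘ c) x = g x := by
    intro x hx
    rw [comp_apply, hcid x hx]
  have hGI : ∀ x, (g ∘ c) x ∈ Icc (-1 : ℝ) 1 := fun x => hmaps (hcI x)
  have hGc : Continuous (g ∘ c) := by
    rw [← continuousOn_univ]
    exact hC.continuousOn.comp hcc.continuousOn fun x _ => hcI x
  have hloc : ∀ x ∈ Ioo (-1 : ℝ) 1, (g ∘ c) =ᶠ[𝓝 x] g := by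
    intro x hx
    filter_upwards [Ioo_mem_nhds hx.1 hx.2] with y hy using hGg y ⟨hy.1.le, hy.2.le⟩
  have hdiff : ∀ x ∈ Ioo (-1 : ℝ) 1, HasDerivAt (g ∘ c) (derivWithin g (Icc (-1) 1) x) x := by
    intro x hx
    have hI : Icc (-1 : ℝ) 1 ∈ 𝓝 x := Icc_mem_nhds hx.1 hx.2
    have h2 := ((hC.differentiableOn one_ne_zero) x ⟨hx.1.le, hx.2.le⟩).hasDerivWithinAt
    exact (h2.hasDerivAt hI).congr_of_eventuallyEq (hloc x hx)
  have hit : ∀ n, ∀ x ∈ Icc (-1 : ℝ) 1, (g ∘ c)^[n] x = g^[n] x ∧ g^[n] x ∈ Icc (-1 : ℝ) 1 := by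
    intro n x hx
    induction n with
    | zero => exact ⟨rfl, hx⟩
    | succ n ih =>
      rw [iterate_succ_apply', iterate_succ_apply', ih.1]
      exact ⟨hGg _ ih.2, hmaps ih.2⟩
  have hfin2 : {x | ∃ n, 0 < n ∧ (g ∘ c)^[n] x = x}.Finite := by
    refine hfin.subset ?_
    rintro x ⟨n, hn, hx⟩
    have hxI : x ∈ Icc (-1 : ℝ) 1 := by
      obtain ⟨m, rfl⟩ : ∃ m, n = m + 1 := ⟨n - 1, by omega⟩
      rw [iterate_succ_apply'] at hx
      rw [← hx]; exact hGI _
    exact ⟨hxI, n, hn, by rw [← (hit n x hxI).1, hx]⟩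
  refine assemble (g ∘ c) hGc hGI ?_ ?_ ?_ ?_ ?_ ?_ hfin2 _ ?_
  · intro x hx y hy hxy
    rw [hGg x ⟨hx.1, hx.2.trans zero_le_one⟩, hGg y ⟨hy.1, hy.2.trans zero_le_one⟩]
    exact hmono hx hy hxy
  · intro x hx y hy hxy
    have hx2 : x ∈ Icc (-1 : ℝ) 1 := ⟨by linarith [hx.1], hx.2⟩
    have hy2 : y ∈ Icc (-1 : ℝ) 1 := ⟨by linarith [hy.1], hy.2⟩
    rw [hGg x hx2, hGg y hy2, ← hsym x hx2, ← hsym y hy2]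
    exact hmono ⟨by linarith [hy.2], by linarith [hy.1]⟩
      ⟨by linarith [hx.2], by linarith [hx.1]⟩ (by linarith)
  · rw [hGg _ (by norm_num), hm1]
  · rw [hGg _ (by norm_num), h1]
  · exact fun x hx => (hdiff x hx).differentiableAt
  · have := hdiff 0 (by norm_num)
    rwa [(hd 0 (by norm_num)).2 rfl] at this
  · intro y
    rw [hGg y.1 y.2]
    rfl
end
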